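/- Assume moreover that dω₀ = 0 (ω₀ symplectic) and let 2 ≤ k ≤ n. Let f₁,…,f_{2n−2k} be smooth functions on M whose differentials are linearly independent at every point, and suppose that the (2n−2k)×(2n−2k) matrix with entries {f_i,f_j}₀ = Λ₀(df_i,df_j) is invertible at every point of an open subset W ⊆ M; let (c_{ij}) denote its (smooth) inverse matrix. Define the 2-form σ = ω₀ + Σ_{i<j} c_{ij} df_i∧df_j on W. Then: (a) σ(X_{f_l},·) = 0 for every l = 1,…,2n−2k; (b) σ has rank 2k at every point of W; (c) i_{Λ₀}σ = −k identically on W; and (d) σ satisfies 2σ∧δ(σ) = δ(σ∧σ) on W. -/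

import Mathlib

namespace Damianou

noncomputable section

/-- Points of `ℝ^N`. -/
abbrev Pt (N : ℕ) := Fin N → ℝ

/-- Raw coordinate representation of a differential `p`-form (or, dually, of a
`p`-vector field): to each point we assign the array of its components. -/
abbrev Form (N p : ℕ) := Pt N → (Fin p → Fin N) → ℝ

/-- The component array of an alternating (antisymmetric) tensor. -/
def AltArr {N p : ℕ} (f : (Fin p → Fin N) → ℝ) : Prop :=
  (∀ (I : Fin p → Fin N) (σ : Equiv.Perm (Fin p)),
      f (I ∘ σ) = ((Equiv.Perm.sign σ : ℤ) : ℝ) * f I) ∧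
  ∀ I : Fin p → Fin N, ¬ Function.Injective I → f I = 0

/-- `ω` is a (smooth) differential `p`-form on the set `M`. -/
def IsFormOn {N p : ℕ} (ω : Form N p) (M : Set (Pt N)) : Prop :=
  (∀ x ∈ M, AltArr (ω x)) ∧ ∀ I, ContDiffOn ℝ (⊤ : ℕ∞) (fun x => ω x I) M

/-- The pairing `⟨η, P⟩` of a `p`-form with a `p`-vector field, determined by
`⟨η₁∧⋯∧η_p, X₁∧⋯∧X_p⟩ = det (⟨η_i, X_j⟩)`. -/
def pairF {N p : ℕ} (η P : Form N p) : Pt N → ℝ :=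
  fun x => (p.factorial : ℝ)⁻¹ * ∑ I : Fin p → Fin N, η x I * P x I

/-- Wedge product (determinant convention). -/
def wedgeF {N : ℕ} (p q : ℕ) (ω : Form N p) (η : Form N q) : Form N (p + q) :=
  fun x I => ((p.factorial : ℝ) * (q.factorial : ℝ))⁻¹ *
    ∑ σ : Equiv.Perm (Fin (p + q)), ((Equiv.Perm.sign σ : ℤ) : ℝ) *
      (ω x fun i => I (σ (Fin.castAdd q i))) * (η x fun j => I (σ (Fin.natAdd p j)))

def smulF {N p : ℕ} (c : ℝ) (ω : Form N p) : Form N p := fun x I => c * ω x I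
def fsmulF {N p : ℕ} (c : Pt N → ℝ) (ω : Form N p) : Form N p := fun x I => c x * ω x I
def addF {N p : ℕ} (ω η : Form N p) : Form N p := fun x I => ω x I + η x I
def subF {N p : ℕ} (ω η : Form N p) : Form N p := fun x I => ω x I - η x I

/-- Cast between (propositionally) equal degrees. -/
def castF {N p q : ℕ} (h : p = q) (ω : Form N p) : Form N q :=
  fun x J => ω x fun t => J (Fin.cast h t)

/-- Total cast, defaulting to `0` when the degrees differ. -/
def castT {N p q : ℕ} (ω : Form N p) : Form N q :=
  if h : p = q then castF h ω else fun _ _ => 0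

/-- Partial derivative `∂f/∂x_i`. -/
def pd {N : ℕ} (f : Pt N → ℝ) (i : Fin N) (x : Pt N) : ℝ :=
  fderiv ℝ f x (Pi.single i 1)

/-- The gradient covector of a function. -/
def grad {N : ℕ} (f : Pt N → ℝ) (x : Pt N) : Fin N → ℝ := fun i => pd f i x

/-- The differential of a function, as a `1`-form. -/
def dF {N : ℕ} (f : Pt N → ℝ) : Form N 1 := fun x I => pd f (I 0) x

/-- Exterior derivative. -/
def extd {N p : ℕ} (ω : Form N p) : Form N (p + 1) :=
  fun x I => ∑ i : Fin (p + 1), (-1 : ℝ) ^ (i : ℕ) *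
    fderiv ℝ (fun y => ω y fun j => I (i.succAbove j)) x (Pi.single (I i) 1)

/-- Concatenation of index blocks of lengths `a` and `b - a` into `Fin b`. -/
def catIdx {N a b : ℕ} (u : Fin a → Fin N) (v : Fin (b - a) → Fin N) : Fin b → Fin N :=
  fun t => if h : (t : ℕ) < a then u ⟨t, h⟩
    else v ⟨(t : ℕ) - a, by have := t.isLt; omega⟩

/-- Concatenation of index blocks of lengths `b - c` and `c` into `Fin b`. -/
def catIdx' {N c b : ℕ} (u : Fin (b - c) → Fin N) (v : Fin c → Fin N) : Fin b → Fin N :=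
  fun t => if h : (t : ℕ) < b - c then u ⟨t, h⟩
    else v ⟨(t : ℕ) - (b - c), by have := t.isLt; omega⟩

/-- Interior product `i_P η` of a `q`-form `η` by a `p`-vector field `P`;
it satisfies `⟨i_P η, Q⟩ = (-1)^{p(p-1)/2} ⟨η, P ∧ Q⟩`. -/
def iF {N : ℕ} (p q : ℕ) (P : Form N p) (η : Form N q) : Form N (q - p) :=
  fun x J => (-1 : ℝ) ^ (p * (p - 1) / 2) * (p.factorial : ℝ)⁻¹ *
    ∑ I : Fin p → Fin N, P x I * η x (catIdx I J)

/-- Interior product `j_η P` of an `r`-vector field `P` by a `q`-form `η`;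
it satisfies `⟨ζ, j_η P⟩ = ⟨ζ ∧ η, P⟩`. -/
def jF {N : ℕ} (q r : ℕ) (η : Form N q) (P : Form N r) : Form N (r - q) :=
  fun x B => (q.factorial : ℝ)⁻¹ * ∑ A : Fin q → Fin N, η x A * P x (catIdx' B A)

/-- The extension of `Λ₀^#` to `p`-forms:
`Λ₀^#(ζ)(α₁,…,α_p) = (-1)^p ζ(Λ₀^#(α₁),…,Λ₀^#(α_p))`, in coordinates. -/
def sharpF {N : ℕ} (Λ : Form N 2) (p : ℕ) (ζ : Form N p) : Form N p :=
  fun x J => (-1 : ℝ) ^ p * ∑ I : Fin p → Fin N, ζ x I * ∏ t, Λ x ![I t, J t]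

/-- `Λ^#` applied to a covector: `⟨β, Λ^#(α)⟩ = Λ(α,β)`. -/
def sharpV {N : ℕ} (Λ : Form N 2) (α : Fin N → ℝ) (x : Pt N) : Fin N → ℝ :=
  fun j => ∑ i, Λ x ![i, j] * α i

/-- The hamiltonian vector field `X_f = Λ₀^#(df)`. -/
def hamV {N : ℕ} (Λ : Form N 2) (f : Pt N → ℝ) (x : Pt N) : Fin N → ℝ :=
  sharpV Λ (grad f x) x

/-- Coefficient matrix of a 2-form (or of a bivector field) at a point. -/
def mat2 {N : ℕ} (ω : Form N 2) (x : Pt N) : Matrix (Fin N) (Fin N) ℝ :=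
  Matrix.of fun i j => ω x ![i, j]

/-- The bracket `{g,h} = Λ(dg,dh)` associated with a bivector field. -/
def braF {N : ℕ} (Λ : Form N 2) (g h : Pt N → ℝ) : Pt N → ℝ :=
  fun x => ∑ i, ∑ j, Λ x ![i, j] * pd g i x * pd h j x

/-- The Jacobi identity for the bracket of `Λ`, for all functions smooth on `M`. -/
def JacobiOn {N : ℕ} (Λ : Form N 2) (M : Set (Pt N)) : Prop :=
  ∀ g h k : Pt N → ℝ, ContDiffOn ℝ (⊤ : ℕ∞) g M → ContDiffOn ℝ (⊤ : ℕ∞) h M →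
    ContDiffOn ℝ (⊤ : ℕ∞) k M →
    ∀ x ∈ M, braF Λ g (braF Λ h k) x + braF Λ h (braF Λ k g) x + braF Λ k (braF Λ g h) x = 0

/-- `f` is a Casimir of `Λ` on `M`, i.e. `Λ(df,·) = 0` on `M`. -/
def CasimirOn {N : ℕ} (Λ : Form N 2) (f : Pt N → ℝ) (M : Set (Pt N)) : Prop :=
  ∀ x ∈ M, ∀ b, ∑ a, Λ x ![a, b] * grad f x a = 0

/-- Wedge powers of a `2`-form (or of a bivector field). -/
def wpow {N : ℕ} (ω : Form N 2) : (m : ℕ) → Form N (2 * m)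
  | 0 => fun _ _ => 1
  | m + 1 => wedgeF (2 * m) 2 (wpow ω m) ω

/-- The wedge `α₁ ∧ ⋯ ∧ α_m` of a family of `1`-forms. -/
def wedgeList {N : ℕ} : (m : ℕ) → (Fin m → Form N 1) → Form N m
  | 0, _ => fun _ _ => 1
  | m + 1, α => wedgeF m 1 (wedgeList m fun i => α i.castSucc) (α (Fin.last m))

/-- `ω₀` is an almost symplectic structure on `M` with associated (nondegenerate)
bivector field `Λ₀`:  `Λ₀^#` is the inverse of `X ↦ -ω₀(X,·)`, which in coordinates
reads `(mat2 ω₀ x) * (mat2 Λ₀ x) = -1`. -/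
def AlmostSymp {N : ℕ} (ω₀ Λ₀ : Form N 2) (M : Set (Pt N)) : Prop :=
  IsFormOn ω₀ M ∧ IsFormOn Λ₀ M ∧ ∀ x ∈ M, mat2 ω₀ x * mat2 Λ₀ x = -1

/-- `ωⁿ/n!`; for an almost symplectic `ω₀` on `ℝ^{2n}` this is the volume form `Ω`,
and for `Λ₀` it is the dual `2n`-vector field `Ω̃`. -/
def volF {N : ℕ} (n : ℕ) (ω : Form N 2) : Form N (2 * n) :=
  smulF ((n.factorial : ℝ)⁻¹) (wpow ω n)

/-- The adjoint `*φ = (-1)^{p(p-1)/2} i_{Λ₀^#(φ)} (ω₀ⁿ/n!)` of a `p`-form. -/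
def adjF {n : ℕ} (ω₀ Λ₀ : Form (2 * n) 2) (p : ℕ) (φ : Form (2 * n) p) :
    Form (2 * n) (2 * n - p) :=
  smulF ((-1 : ℝ) ^ (p * (p - 1) / 2)) (iF p (2 * n) (sharpF Λ₀ p φ) (volF n ω₀))

/-- The codifferential `δ = * ∘ d ∘ *`. -/
def codiffF {n : ℕ} (ω₀ Λ₀ : Form (2 * n) 2) (p : ℕ) (φ : Form (2 * n) p) :
    Form (2 * n) (p - 1) :=
  castT (adjF ω₀ Λ₀ (2 * n - p + 1) (extd (adjF ω₀ Λ₀ p φ)))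

/-- The compatibility condition `2 σ ∧ δ(σ) = δ(σ ∧ σ)` on `M`. -/
def DeltaCond {n : ℕ} (ω₀ Λ₀ σ : Form (2 * n) 2) (M : Set (Pt (2 * n))) : Prop :=
  ∀ x ∈ M, ∀ I : Fin 3 → Fin (2 * n),
    smulF 2 (wedgeF 2 1 σ (codiffF ω₀ Λ₀ 2 σ)) x I = codiffF ω₀ Λ₀ 4 (wedgeF 2 2 σ σ) x I

/-!
STATEMENT 12.  Dirac brackets:  on a symplectic `(M,ω₀)` with
`σ = ω₀ + Σ_{i<j} c_{ij} df_i ∧ df_j` (where `(c_{ij})` is the smooth inverse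
of `({f_i,f_j}₀)` on `W`):  (a) `σ(X_{f_l},·) = 0`;  (b) `σ` has rank `2k` on
`W`;  (c) `i_{Λ₀}σ = -k`;  (d) `2σ∧δ(σ) = δ(σ∧σ)` on `W`.
-/

/-- `σ = ω₀ + Σ_{i<j} c_{ij} df_i ∧ df_j`. -/
def sigmaDirac {n : ℕ} (m : ℕ) (ω₀ : Form (2 * n) 2)
    (f : Fin m → Pt (2 * n) → ℝ) (c : Fin m → Fin m → Pt (2 * n) → ℝ) :
    Form (2 * n) 2 :=
  addF ω₀ (fun x I => ∑ i, ∑ j,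
    if i < j then c i j x * wedgeF 1 1 (dF (f i)) (dF (f j)) x I else 0)

/-- Alternation under permutations of the index slots. -/
def Alt {N p : ℕ} (f : (Fin p → Fin N) → ℝ) : Prop :=
  ∀ (I : Fin p → Fin N) (σ : Equiv.Perm (Fin p)),
    f (I ∘ σ) = ((Equiv.Perm.sign σ : ℤ) : ℝ) * f I

/-- Concatenation of two index blocks. -/
def joinIdx {α : Type*} {a b N : ℕ} (h : a + b = N) (u : Fin a → α) (v : Fin b → α) :
    Fin N → α :=
  fun t => if ht : (t : ℕ) < a then u ⟨t, ht⟩ else v ⟨(t : ℕ) - a, by have := t.isLt; omega⟩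

/-- The Levi-Civita symbol. -/
def lc {N : ℕ} (I : Fin N → Fin N) : ℝ :=
  ((1 : Matrix (Fin N) (Fin N) ℝ).submatrix I id).det

theorem sign_mul_self' {α : Type*} [Fintype α] [DecidableEq α] (σ : Equiv.Perm α) :
    ((Equiv.Perm.sign σ : ℤ) : ℝ) * ((Equiv.Perm.sign σ : ℤ) : ℝ) = 1 := by
  rcases Int.units_eq_one_or (Equiv.Perm.sign σ) with h | h <;> simp [h]

theorem Alt.eq_zero_of_not_injective {N p : ℕ} {f : (Fin p → Fin N) → ℝ} (hf : Alt f)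
    {I : Fin p → Fin N} (hI : ¬ Function.Injective I) : f I = 0 := by
  simp only [Function.Injective, not_forall] at hI
  obtain ⟨a, b, hab, hne⟩ := hI
  have h := hf I (Equiv.swap a b)
  have h2 : I ∘ Equiv.swap a b = I := by
    funext t
    simp only [Function.comp_apply]
    by_cases ha : t = a
    · subst ha; simp [hab]
    · by_cases hb : t = b
      · subst hb; simp [hab]
      · rw [Equiv.swap_apply_of_ne_of_ne ha hb]
  rw [h2, Equiv.Perm.sign_swap hne] at h
  push_cast at h
  linarith

theorem lc_alt {N : ℕ} : Alt (lc (N := N)) := by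
  intro I σ
  have := Matrix.det_permute σ ((1 : Matrix (Fin N) (Fin N) ℝ).submatrix I id)
  rw [lc, lc, ← this]
  rfl

theorem lc_perm_comp {N : ℕ} (π : Equiv.Perm (Fin N)) (I : Fin N → Fin N) :
    lc (π ∘ I) = ((Equiv.Perm.sign π : ℤ) : ℝ) * lc I := by
  have := Matrix.det_permute' (π⁻¹) ((1 : Matrix (Fin N) (Fin N) ℝ).submatrix I id)
  rw [Equiv.Perm.sign_inv] at this
  rw [lc, lc, ← this]
  congr 1
  ext i j
  simp only [Matrix.submatrix_apply, Function.comp_apply, id_eq, Matrix.one_apply,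
    Equiv.Perm.eq_inv_iff_eq]

theorem lc_id {N : ℕ} : lc (id : Fin N → Fin N) = 1 := by
  simp [lc]

theorem lc_perm {N : ℕ} (π : Equiv.Perm (Fin N)) : lc π = ((Equiv.Perm.sign π : ℤ) : ℝ) := by
  simpa [lc_id] using lc_alt id π

theorem Alt.eq_mul_lc {N : ℕ} {f : (Fin N → Fin N) → ℝ} (hf : Alt f) (I : Fin N → Fin N) :
    f I = f id * lc I := by
  by_cases hI : Function.Injective I
  · let π := Equiv.ofBijective I (Finite.injective_iff_bijective.mp hI)
    have h : I = id ∘ π := rfl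
    rw [h, hf, lc_alt, lc_id]; ring
  · rw [hf.eq_zero_of_not_injective hI, lc_alt.eq_zero_of_not_injective hI, mul_zero]

theorem sum_mul_lc {N : ℕ} (F : (Fin N → Fin N) → ℝ) :
    ∑ I, F I * lc I = ∑ π : Equiv.Perm (Fin N), ((Equiv.Perm.sign π : ℤ) : ℝ) * F π := by
  symm
  refine Finset.sum_of_injOn (fun π : Equiv.Perm (Fin N) => (π : Fin N → Fin N)) ?_ ?_ ?_ ?_
  · intro a _ b _ h
    exact DFunLike.coe_injective h
  · intro _ _; simp
  · intro I _ hI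
    rw [lc_alt.eq_zero_of_not_injective, mul_zero]
    intro hinj
    exact hI ⟨Equiv.ofBijective I (Finite.injective_iff_bijective.mp hinj), by simp, rfl⟩
  · intro π _
    rw [lc_perm, mul_comm]

theorem sum_prod_mul_lc {N : ℕ} (A : Matrix (Fin N) (Fin N) ℝ) (J : Fin N → Fin N) :
    ∑ I : Fin N → Fin N, (∏ t, A (J t) (I t)) * lc I = A.det * lc J := by
  rw [sum_mul_lc]
  have h : A.submatrix J id = (1 : Matrix (Fin N) (Fin N) ℝ).submatrix J id * A := by
    ext i j; simp [Matrix.mul_apply, Matrix.one_apply]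
  rw [lc, mul_comm, ← Matrix.det_mul, ← h, ← Matrix.det_transpose, Matrix.det_apply']
  rfl

theorem finRotate_pow_val {N : ℕ} (r : ℕ) (t : Fin N) :
    (((finRotate N ^ r) t : Fin N) : ℕ) = (t + r) % N := by
  induction r with
  | zero => simp [Nat.mod_eq_of_lt t.isLt]
  | succ r ih =>
    rcases N with _ | N
    · exact t.elim0
    · rw [pow_succ', Equiv.Perm.mul_apply, coe_finRotate]
      split_ifs with h
      · rw [h, Fin.val_last] at ih
        rw [← add_assoc, Nat.add_mod, ← ih]
        rcases N with _ | N
        · simp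
        · rw [Nat.mod_eq_of_lt (a := 1) (by omega)]; simp
      · have := Fin.val_lt_last h
        rw [← add_assoc, Nat.add_mod, ← ih]
        rcases N with _ | N
        · simp at this
        · rw [Nat.mod_eq_of_lt (a := 1) (by omega), Nat.mod_eq_of_lt]; omega

theorem lc_join_comm {N r s : ℕ} (h : r + s = N) (h' : s + r = N) (hN : Even N) (hs : 0 < s)
    (J : Fin r → Fin N) (I : Fin s → Fin N) :
    lc (joinIdx h' I J) = (-1) ^ r * lc (joinIdx h J I) := by
  have h2 : joinIdx h' I J = joinIdx h J I ∘ (finRotate N ^ r : Equiv.Perm (Fin N)) := by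
    funext t
    have ht := t.isLt
    have hv := finRotate_pow_val r t
    simp only [joinIdx, Function.comp_apply]
    by_cases hts : (t : ℕ) < s
    · rw [Nat.mod_eq_of_lt (by omega)] at hv
      rw [dif_pos hts, dif_neg (by omega)]
      congr 1; ext; simp; omega
    · have : ((t : ℕ) + r) % N = t - s := by
        rw [Nat.mod_eq_sub_mod (by omega), Nat.mod_eq_of_lt (by omega)]; omega
      rw [this] at hv
      rw [dif_neg hts, dif_pos (by omega)]
      congr 1; ext; simp; omega
  rw [h2, lc_alt, map_pow, sign_finRotate]
  have : Odd (N - 1) := by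
    obtain ⟨m, hm⟩ := hN; exact ⟨m - 1, by omega⟩
  rw [this.neg_one_pow]; push_cast; rfl

theorem laplace_join {N r q : ℕ} (h : r + 1 + q = N) (h' : r + (q + 1) = N) (a : Fin N)
    (I : Fin (r + 1) → Fin N) (K : Fin (q + 1) → Fin N) :
    ∑ j : Fin (r + 1), (-1 : ℝ) ^ (j : ℕ) * (if I j = a then 1 else 0) *
        lc (joinIdx h' (fun t => I (j.succAbove t)) K) +
      ∑ i : Fin (q + 1), (-1 : ℝ) ^ (r + 1 + (i : ℕ)) * (if K i = a then 1 else 0) *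
        lc (joinIdx h I (fun t => K (i.succAbove t))) = 0 := by
  subst h
  let L : Fin (r + 1 + q + 1) → Fin (r + 1 + q) := joinIdx (by omega) I K
  let M : Matrix (Fin (r + 1 + q + 1)) (Fin (r + 1 + q + 1)) ℝ :=
    Matrix.of fun s c => Fin.cases (motive := fun _ => ℝ) (if L s = a then 1 else 0)
      (fun j => if L s = j then 1 else 0) c
  have hdet : M.det = 0 := by
    apply Matrix.det_zero_of_column_eq (i := 0) (j := a.succ) (Fin.succ_ne_zero a).symm
    intro k; simp [M]
  rw [Matrix.det_succ_column_zero] at hdet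
  have hsub : ∀ i : Fin (r + 1 + q + 1), (M.submatrix i.succAbove Fin.succ).det =
      lc (fun t => L (i.succAbove t)) := by
    intro i; rw [lc]; congr 1
  simp only [hsub] at hdet
  change ∑ i : Fin (r + 1 + (q + 1)), _ = _ at hdet
  rw [Fin.sum_univ_add] at hdet
  refine Eq.trans ?_ hdet
  congr 1
  · refine Finset.sum_congr rfl fun j _ => ?_
    have h1 : L (Fin.castAdd (q + 1) j) = I j := by
      have := j.isLt
      simp only [L, joinIdx, Fin.val_castAdd]
      rw [dif_pos this]
    congr 1
    · simp only [M, Matrix.of_apply, Fin.cases_zero, h1]; simp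
    · congr 1; funext t
      have := t.isLt
      have hj := j.isLt
      by_cases htj : (t : ℕ) < j
      · rw [Fin.succAbove_of_castSucc_lt _ _ (by simpa [Fin.lt_def] using htj)]
        simp only [L, joinIdx]
        rw [dif_pos (by omega), dif_pos (by simp; omega),
          Fin.succAbove_of_castSucc_lt _ _ (by simpa [Fin.lt_def] using htj)]
        rfl
      · rw [Fin.succAbove_of_le_castSucc _ _ (by simp [Fin.le_def]; omega)]
        simp only [L, joinIdx]
        by_cases htr : (t : ℕ) < r
        · rw [dif_pos htr, dif_pos (by simp; omega),
            Fin.succAbove_of_le_castSucc _ _ (by simp [Fin.le_def]; omega)]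
          rfl
        · rw [dif_neg htr, dif_neg (by simp; omega)]
          congr 1; ext; simp
  · refine Finset.sum_congr rfl fun i _ => ?_
    have h1 : L (Fin.natAdd (r + 1) i) = K i := by
      simp only [L, joinIdx, Fin.val_natAdd]
      rw [dif_neg (by omega)]
      congr 1; ext; simp
    congr 1
    · simp only [M, Matrix.of_apply, Fin.cases_zero, h1]; simp
    · congr 1; funext t
      have := t.isLt
      have hi := i.isLt
      by_cases htr : (t : ℕ) < r + 1
      · rw [Fin.succAbove_of_castSucc_lt _ _ (by simp [Fin.lt_def]; omega)]
        simp only [L, joinIdx]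
        rw [dif_pos htr, dif_pos (by simpa using htr)]
        rfl
      · simp only [joinIdx]
        rw [dif_neg htr]
        by_cases hti : (t : ℕ) < r + 1 + i
        · rw [Fin.succAbove_of_castSucc_lt _ _ (by simp [Fin.lt_def]; omega),
            Fin.succAbove_of_castSucc_lt _ _ (by simp [Fin.lt_def]; omega)]
          simp only [L, joinIdx]
          rw [dif_neg (by simpa using htr)]
          congr 1
        · rw [Fin.succAbove_of_le_castSucc _ _ (by simp [Fin.le_def]; omega),
            Fin.succAbove_of_le_castSucc _ _ (by simp [Fin.le_def]; omega)]
          simp only [L, joinIdx]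
          rw [dif_neg (by simp; omega)]
          congr 1; ext; simp; omega

theorem Alt.insertNth {N r : ℕ} {f : (Fin (r + 1) → Fin N) → ℝ} (hf : Alt f) (j : Fin (r + 1))
    (a : Fin N) (A : Fin r → Fin N) :
    (-1 : ℝ) ^ (j : ℕ) * f (j.insertNth (α := fun _ => Fin N) a A) =
      f (Fin.cons (α := fun _ => Fin N) a A) := by
  rw [← Fin.cons_comp_cycleRange, hf, Fin.sign_cycleRange]
  push_cast
  rw [← mul_assoc, ← mul_pow]
  simp

theorem sum_ext_lc {N r q : ℕ} (h : r + 1 + q = N) (h' : r + (q + 1) = N)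
    (D : Fin N → (Fin (r + 1) → Fin N) → ℝ) (hD : ∀ a, Alt (D a)) (K : Fin (q + 1) → Fin N) :
    ∑ i : Fin (q + 1), (-1 : ℝ) ^ (i : ℕ) *
        ∑ I, D (K i) I * lc (joinIdx h I (fun t => K (i.succAbove t))) =
      (-1 : ℝ) ^ r * (r + 1) * ∑ A : Fin r → Fin N,
        (∑ a, D a (Fin.cons (α := fun _ => Fin N) a A)) * lc (joinIdx h' A K) := by
  have key : ∑ a, ∑ I, D a I * (∑ j : Fin (r + 1), (-1 : ℝ) ^ (j : ℕ) * (if I j = a then 1 else 0) *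
        lc (joinIdx h' (fun t => I (j.succAbove t)) K) +
      ∑ i : Fin (q + 1), (-1 : ℝ) ^ (r + 1 + (i : ℕ)) * (if K i = a then 1 else 0) *
        lc (joinIdx h I (fun t => K (i.succAbove t)))) = 0 := by
    simp only [laplace_join, mul_zero, Finset.sum_const_zero]
  simp only [mul_add, Finset.sum_add_distrib, Finset.mul_sum] at key
  have h1 : ∑ a, ∑ I, ∑ j : Fin (r + 1), D a I * ((-1 : ℝ) ^ (j : ℕ) * (if I j = a then 1 else 0) *
        lc (joinIdx h' (fun t => I (j.succAbove t)) K)) =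
      (r + 1) * ∑ A : Fin r → Fin N,
        (∑ a, D a (Fin.cons (α := fun _ => Fin N) a A)) * lc (joinIdx h' A K) := by
    calc _ = ∑ j : Fin (r + 1), ∑ I : Fin (r + 1) → Fin N, (-1 : ℝ) ^ (j : ℕ) * D (I j) I *
          lc (joinIdx h' (fun t => I (j.succAbove t)) K) := by
          rw [Finset.sum_comm]
          simp_rw [Finset.sum_comm (s := (Finset.univ : Finset (Fin N)))]
          rw [Finset.sum_comm]
          refine Finset.sum_congr rfl fun j _ => Finset.sum_congr rfl fun I _ => ?_
          rw [Finset.sum_eq_single (I j)]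
          · simp; ring
          · intro b _ hb; simp [hb.symm]
          · simp
      _ = ∑ j : Fin (r + 1), ∑ A : Fin r → Fin N,
            (∑ a, D a (Fin.cons (α := fun _ => Fin N) a A)) * lc (joinIdx h' A K) := by
          refine Finset.sum_congr rfl fun j _ => ?_
          rw [← (Fin.insertNthEquiv (fun _ => Fin N) j).sum_comp, Fintype.sum_prod_type,
            Finset.sum_comm]
          refine Finset.sum_congr rfl fun A _ => ?_
          rw [Finset.sum_mul]
          refine Finset.sum_congr rfl fun a _ => ?_
          simp only [Fin.insertNthEquiv_apply, Fin.insertNth_apply_same,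
            Fin.insertNth_apply_succAbove]
          rw [← (hD a).insertNth j a A]
          rfl
      _ = _ := by simp
  have h2 : ∑ a, ∑ I, ∑ i : Fin (q + 1), D a I * ((-1 : ℝ) ^ (r + 1 + (i : ℕ)) *
        (if K i = a then 1 else 0) * lc (joinIdx h I (fun t => K (i.succAbove t)))) =
      (-1) ^ (r + 1) * ∑ i : Fin (q + 1), (-1 : ℝ) ^ (i : ℕ) *
        ∑ I, D (K i) I * lc (joinIdx h I (fun t => K (i.succAbove t))) := by
    rw [Finset.sum_comm]
    simp_rw [Finset.sum_comm (s := (Finset.univ : Finset (Fin N)))]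
    rw [Finset.sum_comm, Finset.mul_sum]
    refine Finset.sum_congr rfl fun i _ => ?_
    rw [← mul_assoc, ← pow_add, Finset.mul_sum]
    refine Finset.sum_congr rfl fun I _ => ?_
    rw [Finset.sum_eq_single (K i)]
    · simp; ring
    · intro b _ hb; simp [hb.symm]
    · simp
  rw [h1, h2] at key
  have h3 : (-1 : ℝ) ^ r * (-1) ^ r = 1 := by rw [← mul_pow]; simp
  have := congrArg (fun z => (-1 : ℝ) ^ r * z) key
  simp only [mul_add, mul_zero, pow_succ] at this
  linear_combination (-1 : ℝ) * this - (∑ i : Fin (q + 1), (-1 : ℝ) ^ (i : ℕ) *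
        ∑ I, D (K i) I * lc (joinIdx h I (fun t => K (i.succAbove t)))) * h3

/-- Splitting an index block of length `r + s`. -/
def joinEquiv {α : Type*} {r s N : ℕ} (h : r + s = N) :
    (Fin r → α) × (Fin s → α) ≃ (Fin N → α) where
  toFun u := joinIdx h u.1 u.2
  invFun I := (fun t => I ⟨t, by omega⟩, fun t => I ⟨r + t, by omega⟩)
  left_inv u := by
    ext1
    · funext t; simp [joinIdx]
    · funext t; simp [joinIdx]
  right_inv I := by
    funext t
    simp only [joinIdx]
    split_ifs
    · rfl
    · congr 1; ext; simp; omega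

theorem prod_joinIdx {α : Type*} {r s N : ℕ} (h : r + s = N) (u v : Fin r → α) (u' v' : Fin s → α)
    (F : α → α → ℝ) :
    ∏ t, F (joinIdx h u u' t) (joinIdx h v v' t) = (∏ t, F (u t) (v t)) * ∏ t, F (u' t) (v' t) := by
  subst h
  rw [Fin.prod_univ_add]
  congr 1 <;> refine Finset.prod_congr rfl fun t _ => ?_
  · have : ∀ w : Fin r → α, ∀ w' : Fin s → α, joinIdx rfl w w' (Fin.castAdd s t) = w t := by
      intro w w'; simp [joinIdx]
    rw [this, this]
  · have : ∀ w : Fin r → α, ∀ w' : Fin s → α, joinIdx rfl w w' (Fin.natAdd r t) = w' t := by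
      intro w w'; simp [joinIdx]
    rw [this, this]

theorem sum_prod_mul_lc_join {N r s : ℕ} (h : r + s = N) (A : Matrix (Fin N) (Fin N) ℝ)
    (B : Fin r → Fin N) (I : Fin s → Fin N) :
    ∑ A' : Fin r → Fin N, ∑ K : Fin s → Fin N,
      (∏ t, A (B t) (A' t)) * (∏ t, A (I t) (K t)) * lc (joinIdx h A' K) =
      A.det * lc (joinIdx h B I) := by
  rw [← sum_prod_mul_lc, ← (joinEquiv h).sum_comp, Fintype.sum_prod_type]
  simp only [joinEquiv, Equiv.coe_fn_mk, prod_joinIdx h B _ I _ fun i j => A i j]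

theorem comp_joinIdx {α β : Type*} {r s N : ℕ} (h : r + s = N) (g : α → β) (u : Fin r → α)
    (v : Fin s → α) : g ∘ joinIdx h u v = joinIdx h (g ∘ u) (g ∘ v) := by
  funext t; simp only [joinIdx, Function.comp_apply]; split_ifs <;> rfl

theorem joinIdx_split {α : Type*} {r s N : ℕ} (h : r + s = N) (I : Fin N → α) :
    joinIdx h (fun t => I ⟨t, by omega⟩) (fun t => I ⟨r + t, by omega⟩) = I :=
  (joinEquiv h).apply_symm_apply I

/-- A block permutation. -/
def blockPerm {r s N : ℕ} (h : r + s = N) (u : Equiv.Perm (Fin r) × Equiv.Perm (Fin s)) :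
    Equiv.Perm (Fin N) :=
  (finSumFinEquiv.trans (finCongr h)).permCongr (Equiv.Perm.sumCongr u.1 u.2)

theorem sign_blockPerm {r s N : ℕ} (h : r + s = N)
    (u : Equiv.Perm (Fin r) × Equiv.Perm (Fin s)) :
    Equiv.Perm.sign (blockPerm h u) = Equiv.Perm.sign u.1 * Equiv.Perm.sign u.2 := by
  rw [blockPerm, Equiv.Perm.sign_permCongr, Equiv.Perm.sign_sumCongr]

theorem blockPerm_left {r s N : ℕ} (h : r + s = N)
    (u : Equiv.Perm (Fin r) × Equiv.Perm (Fin s)) (t : Fin r) :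
    blockPerm h u ⟨t, by omega⟩ = ⟨u.1 t, by omega⟩ := by
  subst h
  have h1 : (⟨t, by omega⟩ : Fin (r + s)) = Fin.castAdd s t := rfl
  rw [h1, blockPerm, Equiv.permCongr_apply]
  simp [Fin.ext_iff]

theorem blockPerm_right {r s N : ℕ} (h : r + s = N)
    (u : Equiv.Perm (Fin r) × Equiv.Perm (Fin s)) (t : Fin s) :
    blockPerm h u ⟨r + t, by omega⟩ = ⟨r + u.2 t, by omega⟩ := by
  subst h
  have h1 : (⟨r + t, by omega⟩ : Fin (r + s)) = Fin.natAdd r t := rfl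
  rw [h1, blockPerm, Equiv.permCongr_apply]
  simp [Fin.ext_iff]

theorem blockPerm_injective {r s N : ℕ} (h : r + s = N) : Function.Injective (blockPerm h) := by
  intro u v huv
  ext t
  · have := congrArg (fun π : Equiv.Perm (Fin N) => π ⟨t, by omega⟩) huv
    simp only [blockPerm_left, Fin.ext_iff] at this
    exact this
  · have := congrArg (fun π : Equiv.Perm (Fin N) => π ⟨r + t, by omega⟩) huv
    simp only [blockPerm_right, Fin.ext_iff] at this
    omega

theorem exists_blockPerm {r s N : ℕ} (h : r + s = N) (π : Equiv.Perm (Fin N))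
    (hπ : ∀ t : Fin s, r ≤ (π ⟨r + t, by omega⟩ : ℕ)) : ∃ u, blockPerm h u = π := by
  subst h
  have hr : Set.MapsTo (finSumFinEquiv.symm.permCongr π) (Set.range (Sum.inr : Fin s → Fin r ⊕ Fin s))
      (Set.range Sum.inr) := by
    rintro _ ⟨t, rfl⟩
    have ht := hπ t
    change r ≤ (π (Fin.natAdd r t) : ℕ) at ht
    refine ⟨⟨(π (Fin.natAdd r t) : ℕ) - r, by have := (π (Fin.natAdd r t)).isLt; omega⟩, ?_⟩
    simp only [Equiv.permCongr_apply, Equiv.symm_symm, finSumFinEquiv_apply_right]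
    rw [Equiv.eq_symm_apply, finSumFinEquiv_apply_right]
    ext
    simp only [Fin.val_natAdd]
    omega
  obtain ⟨u, hu⟩ := Equiv.Perm.mem_sumCongrHom_range_of_perm_mapsTo_inl
    ((Equiv.Perm.perm_mapsTo_inl_iff_mapsTo_inr _).mpr hr)
  refine ⟨u, ?_⟩
  rw [Equiv.Perm.sumCongrHom_apply] at hu
  rw [blockPerm, hu]
  ext t
  simp [Equiv.permCongr_apply]

theorem exists_perm_extend {r N : ℕ} (h : r ≤ N) {J : Fin r → Fin N} (hJ : Function.Injective J) :
    ∃ ρ : Equiv.Perm (Fin N), ∀ t : Fin r, ρ ⟨t, by omega⟩ = J t := by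
  classical
  let e : {x : Fin N // (x : ℕ) < r} ≃ {x : Fin N // x ∈ Set.range J} :=
    (Equiv.mk (fun x => (⟨x.1, x.2⟩ : Fin r)) (fun t => ⟨⟨t, by omega⟩, t.2⟩)
      (fun _ => rfl) (fun _ => rfl)).trans (Equiv.ofInjective J hJ)
  refine ⟨e.extendSubtype, fun t => ?_⟩
  rw [Equiv.extendSubtype_apply_of_mem e _ t.2]
  rfl

theorem sum_lc_mul_lc {N r s : ℕ} (h : r + s = N) {T : (Fin r → Fin N) → ℝ} (hT : Alt T)
    (J : Fin r → Fin N) :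
    ∑ B : Fin r → Fin N, ∑ I : Fin s → Fin N,
      T B * lc (joinIdx h B I) * lc (joinIdx h J I) = r.factorial * s.factorial * T J := by
  by_cases hJ : Function.Injective J
  swap
  · rw [hT.eq_zero_of_not_injective hJ, mul_zero]
    refine Finset.sum_eq_zero fun B _ => Finset.sum_eq_zero fun I _ => ?_
    rw [lc_alt.eq_zero_of_not_injective (I := joinIdx h J I), mul_zero]
    intro hinj
    apply hJ
    intro a b hab
    have := @hinj ⟨a, by omega⟩ ⟨b, by omega⟩ (by simp [joinIdx, hab])
    simpa [Fin.ext_iff] using this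
  obtain ⟨ρ, hρ⟩ := exists_perm_extend (by omega) hJ
  let F : (Fin N → Fin N) → ℝ := fun I => T (fun t => I ⟨t, by omega⟩) *
    lc (joinIdx h J (fun t => I ⟨r + t, by omega⟩))
  have h1 : ∑ B : Fin r → Fin N, ∑ I : Fin s → Fin N,
      T B * lc (joinIdx h B I) * lc (joinIdx h J I) = ∑ I, F I * lc I := by
    rw [← (joinEquiv h).sum_comp, Fintype.sum_prod_type]
    refine Finset.sum_congr rfl fun B _ => Finset.sum_congr rfl fun I _ => ?_
    have := (joinEquiv h).symm_apply_apply (B, I)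
    have hB := congrArg Prod.fst this
    have hI := congrArg Prod.snd this
    simp only [joinEquiv, Equiv.coe_fn_mk, Equiv.coe_fn_symm_mk] at hB hI
    simp only [F, joinEquiv, Equiv.coe_fn_mk, hB, hI]
    ring
  have hl : J = ρ ∘ fun t : Fin r => (⟨t, by omega⟩ : Fin N) := by
    funext t; exact (hρ t).symm
  have h2 : ∀ π : Equiv.Perm (Fin N), ((Equiv.Perm.sign (ρ * π) : ℤ) : ℝ) * F (ρ * π : Equiv.Perm (Fin N)) =
      ((Equiv.Perm.sign π : ℤ) : ℝ) * T (fun t => ρ (π ⟨t, by omega⟩)) *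
        lc (joinIdx h (fun t : Fin r => (⟨t, by omega⟩ : Fin N)) (fun t => π ⟨r + t, by omega⟩)) := by
    intro π
    have : joinIdx h J (fun t => (ρ * π : Equiv.Perm (Fin N)) ⟨r + t, by omega⟩) =
        ρ ∘ joinIdx h (fun t : Fin r => (⟨t, by omega⟩ : Fin N)) (fun t => π ⟨r + t, by omega⟩) := by
      rw [comp_joinIdx, ← hl]; rfl
    simp only [F]
    rw [this, lc_perm_comp, map_mul]
    push_cast
    simp only [Function.comp_apply]
    linear_combination ((Equiv.Perm.sign π : ℤ) : ℝ) * T (fun t => ρ (π ⟨t, by omega⟩)) *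
        lc (joinIdx h (fun t : Fin r => (⟨t, by omega⟩ : Fin N)) (fun t => π ⟨r + t, by omega⟩)) *
        sign_mul_self' ρ
  rw [h1, sum_mul_lc, ← Equiv.sum_comp (Equiv.mulLeft ρ)]
  simp only [Equiv.coe_mulLeft, h2]
  have h3 : ∑ u : Equiv.Perm (Fin r) × Equiv.Perm (Fin s), T J =
      ∑ π : Equiv.Perm (Fin N), ((Equiv.Perm.sign π : ℤ) : ℝ) * T (fun t => ρ (π ⟨t, by omega⟩)) *
        lc (joinIdx h (fun t : Fin r => (⟨t, by omega⟩ : Fin N)) (fun t => π ⟨r + t, by omega⟩)) := by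
    refine Finset.sum_of_injOn (blockPerm h) (blockPerm_injective h).injOn (by simp) ?_ ?_
    · intro π _ hπ
      rw [lc_alt.eq_zero_of_not_injective, mul_zero]
      intro hinj
      apply hπ
      obtain ⟨u, hu⟩ := exists_blockPerm h π (fun t => by
        by_contra hlt
        push Not at hlt
        have := @hinj ⟨r + t, by omega⟩ ⟨π ⟨r + t, by omega⟩, by omega⟩
          (by simp [joinIdx, hlt])
        simp only [Fin.ext_iff] at this
        omega)
      exact ⟨u, by simp, hu⟩
    · intro u _
      have e1 : (fun t : Fin r => ρ (blockPerm h u ⟨t, by omega⟩)) = J ∘ u.1 := by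
        funext t; rw [blockPerm_left]; exact hρ (u.1 t)
      have e2 : joinIdx h (fun t : Fin r => (⟨t, by omega⟩ : Fin N))
          (fun t => blockPerm h u ⟨r + t, by omega⟩) = blockPerm h (1, u.2) := by
        rw [← joinIdx_split h (blockPerm h (1, u.2))]
        congr 1
        · funext t; rw [blockPerm_left]; rfl
        · funext t; rw [blockPerm_right, blockPerm_right]
      rw [e1, e2, hT, lc_perm, sign_blockPerm, sign_blockPerm]
      simp only [map_one, one_mul]
      push_cast
      linear_combination (-T J) * (sign_mul_self' u.1 * ((Equiv.Perm.sign u.2 : ℤ) : ℝ) ^ 2) -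
        T J * sign_mul_self' u.2
  rw [← h3]
  simp [Fintype.card_perm]

theorem alt_wedgeF {N p q : ℕ} (ω : Form N p) (η : Form N q) (x : Pt N) :
    Alt (wedgeF p q ω η x) := by
  intro I τ
  simp only [wedgeF]
  rw [mul_left_comm]
  congr 1
  rw [Finset.mul_sum]
  conv_rhs => rw [← Equiv.sum_comp (Equiv.mulLeft τ)]
  refine Finset.sum_congr rfl fun σ _ => ?_
  simp only [Equiv.coe_mulLeft, map_mul, Equiv.Perm.coe_mul, Function.comp_apply]
  push_cast
  have h := sign_mul_self' τ
  linear_combination (-((Equiv.Perm.sign σ : ℤ) : ℝ) *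
    (ω x fun i => I (τ (σ (Fin.castAdd q i)))) * (η x fun j => I (τ (σ (Fin.natAdd p j))))) * h

theorem alt_sharpF {N p : ℕ} (Λ : Form N 2) {φ : Form N p} {x : Pt N} (h : Alt (φ x)) :
    Alt (sharpF Λ p φ x) := by
  intro J σ
  simp only [sharpF]
  rw [mul_left_comm]
  congr 1
  rw [Finset.mul_sum, ← Equiv.sum_comp (Equiv.arrowCongr σ.symm (Equiv.refl (Fin N)))]
  refine Finset.sum_congr rfl fun I _ => ?_
  have h1 : (Equiv.arrowCongr σ.symm (Equiv.refl (Fin N))) I = I ∘ σ := by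
    funext t; simp [Equiv.arrowCongr]
  rw [h1, h]
  simp only [Function.comp_apply]
  rw [Equiv.prod_comp σ (fun t => Λ x ![I t, J t])]
  ring

theorem volF_eq {n : ℕ} (hn : 0 < n) (ω : Form (2 * n) 2) (y : Pt (2 * n))
    (I : Fin (2 * n) → Fin (2 * n)) : volF n ω y I = volF n ω y id * lc I := by
  obtain ⟨m, rfl⟩ := Nat.exists_eq_succ_of_ne_zero hn.ne'
  have h : Alt (wpow ω (m + 1) y) := alt_wedgeF (wpow ω m) ω y
  simp only [volF, smulF]
  rw [h.eq_mul_lc I, mul_assoc]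

theorem adjF_apply {n p : ℕ} (hn : 0 < n) (h : p + (2 * n - p) = 2 * n) (ω Λ : Form (2 * n) 2)
    (φ : Form (2 * n) p) (y : Pt (2 * n)) (J : Fin (2 * n - p) → Fin (2 * n)) :
    adjF ω Λ p φ y J = (p.factorial : ℝ)⁻¹ *
      ∑ I, (volF n ω y id * sharpF Λ p φ y I) * lc (joinIdx h I J) := by
  have hc : ∀ I : Fin p → Fin (2 * n), catIdx I J = joinIdx h I J := fun I => rfl
  have hv : ∀ I : Fin p → Fin (2 * n), volF n ω y (joinIdx h I J) =
      volF n ω y id * lc (joinIdx h I J) := fun I => volF_eq hn ω y _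
  simp only [adjF, smulF, iF, hc, hv]
  have e : (-1 : ℝ) ^ (p * (p - 1) / 2) * (-1) ^ (p * (p - 1) / 2) = 1 := by
    rw [← mul_pow, neg_mul_neg, one_mul, one_pow]
  rw [← mul_assoc, ← mul_assoc, e, one_mul]
  congr 1
  refine Finset.sum_congr rfl fun I _ => by ring

theorem alt_fderiv {N p : ℕ} {P : Form N p} {x : Pt N} (hP : ∀ᶠ y in nhds x, Alt (P y))
    (v : Pt N) : Alt (fun I => fderiv ℝ (fun y => P y I) x v) := by
  intro I σ
  have h : (fun y => P y (I ∘ σ)) =ᶠ[nhds x] fun y => ((Equiv.Perm.sign σ : ℤ) : ℝ) * P y I := by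
    filter_upwards [hP] with y hy using hy I σ
  simp only
  rw [h.fderiv_eq]
  by_cases hd : DifferentiableAt ℝ (fun y => P y I) x
  · rw [fderiv_const_mul hd]; rfl
  · rw [fderiv_zero_of_not_differentiableAt hd, fderiv_zero_of_not_differentiableAt]
    · simp
    · intro h2
      apply hd
      have h3 := h2.const_mul (((Equiv.Perm.sign σ : ℤ) : ℝ))
      refine h3.congr_of_eventuallyEq (Filter.Eventually.of_forall fun y => ?_)
      simp only
      rw [← mul_assoc, sign_mul_self', one_mul]

theorem alt_volF_mul_sharpF {n p : ℕ} (ω Λ : Form (2 * n) 2) {φ : Form (2 * n) p}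
    {x : Pt (2 * n)} (hφ : ∀ᶠ y in nhds x, Alt (φ y)) :
    ∀ᶠ y in nhds x, Alt (fun I => volF n ω y id * sharpF Λ p φ y I) := by
  filter_upwards [hφ] with y hy
  intro I σ
  simp only
  rw [alt_sharpF Λ hy]; ring

theorem extd_adjF_apply {n r : ℕ} (hr : r + 1 ≤ 2 * n) (h' : r + (2 * n - (r + 1) + 1) = 2 * n)
    (ω Λ : Form (2 * n) 2)
    (φ : Form (2 * n) (r + 1)) (x : Pt (2 * n)) (hφ : ∀ᶠ y in nhds x, Alt (φ y))
    (hd : ∀ I, DifferentiableAt ℝ (fun y => volF n ω y id * sharpF Λ (r + 1) φ y I) x)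
    (K : Fin (2 * n - (r + 1) + 1) → Fin (2 * n)) :
    extd (adjF ω Λ (r + 1) φ) x K = (-1) ^ r * (r.factorial : ℝ)⁻¹ *
      ∑ A : Fin r → Fin (2 * n),
        (∑ a, pd (fun y => volF n ω y id *
          sharpF Λ (r + 1) φ y (Fin.cons (α := fun _ => Fin (2 * n)) a A)) a x) *
        lc (joinIdx h' A K) := by
  have h : r + 1 + (2 * n - (r + 1)) = 2 * n := by omega
  simp only [extd]
  have h1 : ∀ i : Fin (2 * n - (r + 1) + 1),
      fderiv ℝ (fun y => adjF ω Λ (r + 1) φ y fun j => K (i.succAbove j)) x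
        (Pi.single (K i) 1) = ((r + 1).factorial : ℝ)⁻¹ * ∑ I,
        fderiv ℝ (fun y => volF n ω y id * sharpF Λ (r + 1) φ y I) x (Pi.single (K i) 1) *
          lc (joinIdx h I fun j => K (i.succAbove j)) := by
    intro i
    simp only [adjF_apply (show 0 < n by omega) h]
    rw [fderiv_const_mul (DifferentiableAt.fun_sum fun I _ => (hd I).mul_const _),
      fderiv_fun_sum fun I _ => (hd I).mul_const _]
    simp only [smul_apply, sum_apply, smul_eq_mul]
    congr 1
    refine Finset.sum_congr rfl fun I _ => ?_
    rw [fderiv_mul_const (hd I)]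
    simp [mul_comm]
  simp only [h1]
  have h2 := sum_ext_lc h h' (fun a I => fderiv ℝ
    (fun y => volF n ω y id * sharpF Λ (r + 1) φ y I) x (Pi.single a 1)) (fun a =>
      alt_fderiv (alt_volF_mul_sharpF ω Λ hφ) _) K
  simp only [mul_left_comm _ (((r + 1).factorial : ℝ)⁻¹), ← Finset.mul_sum]
  rw [h2, Nat.factorial_succ]
  push_cast
  have : ((r : ℝ) + 1) ≠ 0 := by positivity
  have : (r.factorial : ℝ) ≠ 0 := by positivity
  field_simp
  rfl

/-- Raising by a left inverse undoes lowering. -/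
theorem sum_prod_inverse {N r : ℕ} {A B : Matrix (Fin N) (Fin N) ℝ} (h : A * B = 1)
    (Q : (Fin r → Fin N) → ℝ) (I : Fin r → Fin N) :
    ∑ J : Fin r → Fin N, (∏ t, A (I t) (J t)) * ∑ K : Fin r → Fin N, (∏ t, B (J t) (K t)) * Q K =
      Q I := by
  simp only [Finset.mul_sum]
  rw [Finset.sum_comm]
  have h1 : ∀ K : Fin r → Fin N, ∑ J : Fin r → Fin N, (∏ t, A (I t) (J t)) *
      ((∏ t, B (J t) (K t)) * Q K) = (if I = K then 1 else 0) * Q K := by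
    intro K
    simp only [← mul_assoc, ← Finset.prod_mul_distrib, ← Finset.sum_mul]
    congr 1
    rw [← Fintype.prod_sum (fun t j => A (I t) j * B j (K t))]
    simp only [← Matrix.mul_apply, h, Matrix.one_apply]
    rw [Finset.prod_ite_zero]
    simp [funext_iff]
  simp [h1]

theorem Alt.sum_cons {N r : ℕ} {D : Fin N → (Fin (r + 1) → Fin N) → ℝ} (hD : ∀ a, Alt (D a)) :
    Alt (fun A : Fin r → Fin N => ∑ a, D a (Fin.cons (α := fun _ => Fin N) a A)) := by
  intro A σ
  simp only
  rw [Finset.mul_sum]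
  refine Finset.sum_congr rfl fun a _ => ?_
  have h : Fin.cons (α := fun _ => Fin N) a (A ∘ σ) =
      Fin.cons (α := fun _ => Fin N) a A ∘ Equiv.Perm.decomposeFin.symm (0, σ) := by
    funext t
    refine Fin.cases ?_ (fun t => ?_) t <;> simp
  rw [h, hD, Equiv.Perm.decomposeFin.symm_sign]
  simp

theorem Alt.sum_prod {N r : ℕ} {Q : (Fin r → Fin N) → ℝ} (hQ : Alt Q)
    (M : Fin N → Fin N → ℝ) :
    Alt (fun J : Fin r → Fin N => ∑ B : Fin r → Fin N, (∏ t, M (J t) (B t)) * Q B) := by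
  intro J σ
  simp only
  rw [Finset.mul_sum, ← Equiv.sum_comp (Equiv.arrowCongr σ.symm (Equiv.refl (Fin N)))]
  refine Finset.sum_congr rfl fun I _ => ?_
  have h1 : (Equiv.arrowCongr σ.symm (Equiv.refl (Fin N))) I = I ∘ σ := by
    funext t; simp [Equiv.arrowCongr]
  rw [h1, hQ]
  simp only [Function.comp_apply]
  rw [Equiv.prod_comp σ (fun t => M (J t) (I t))]
  ring

theorem codiffF_apply {n r : ℕ} (hr : r + 1 ≤ 2 * n) (ω Λ : Form (2 * n) 2)
    (φ : Form (2 * n) (r + 1)) (x : Pt (2 * n)) (hφ : ∀ᶠ y in nhds x, Alt (φ y))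
    (hΛ : ∀ i j, Λ x ![i, j] = -Λ x ![j, i]) (hωΛ : (mat2 Λ x).transpose * mat2 ω x = 1)
    (hd : ∀ I, DifferentiableAt ℝ (fun y => volF n ω y id * sharpF Λ (r + 1) φ y I) x)
    (J : Fin r → Fin (2 * n)) :
    codiffF ω Λ (r + 1) φ x J = volF n ω x id * (mat2 Λ x).det *
      ∑ B : Fin r → Fin (2 * n), (∏ t, ω x ![J t, B t]) *
        ∑ a, pd (fun y => volF n ω y id *
          sharpF Λ (r + 1) φ y (Fin.cons (α := fun _ => Fin (2 * n)) a B)) a x := by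
  set Q : (Fin r → Fin (2 * n)) → ℝ := fun A => ∑ a, pd (fun y => volF n ω y id *
          sharpF Λ (r + 1) φ y (Fin.cons (α := fun _ => Fin (2 * n)) a A)) a x with hQ
  set T : (Fin r → Fin (2 * n)) → ℝ := fun J => ∑ B : Fin r → Fin (2 * n),
    (∏ t, ω x ![J t, B t]) * Q B with hT
  have h' : r + (2 * n - (r + 1) + 1) = 2 * n := by omega
  have hn : 0 < n := by omega
  have hQalt : Alt Q := Alt.sum_cons (D := fun a I => pd (fun y => volF n ω y id *
    sharpF Λ (r + 1) φ y I) a x) fun a => alt_fderiv (alt_volF_mul_sharpF ω Λ hφ) _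
  have hTalt : Alt T := hQalt.sum_prod fun i j => ω x ![i, j]
  have hQT : ∀ A, Q A = ∑ B : Fin r → Fin (2 * n), (∏ t, Λ x ![B t, A t]) * T B := by
    intro A
    exact (sum_prod_inverse hωΛ Q A).symm
  set ψ := extd (adjF ω Λ (r + 1) φ) with hψ
  have hsharp : ∀ I, sharpF Λ (2 * n - (r + 1) + 1) ψ x I =
      (-1) ^ r * (r.factorial : ℝ)⁻¹ * (mat2 Λ x).det * ∑ B, T B * lc (joinIdx h' B I) := by
    intro I
    have e1 : ∀ B, (mat2 Λ x).det * lc (joinIdx h' B I) = ∑ A : Fin r → Fin (2 * n),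
        ∑ K : Fin (2 * n - (r + 1) + 1) → Fin (2 * n), (∏ t, Λ x ![B t, A t]) *
          (∏ t, Λ x ![I t, K t]) * lc (joinIdx h' A K) := fun B =>
      (sum_prod_mul_lc_join h' (mat2 Λ x) B I).symm
    have e2 : ∀ K : Fin (2 * n - (r + 1) + 1) → Fin (2 * n), ∏ t, Λ x ![K t, I t] =
        (-1) ^ (2 * n - (r + 1) + 1) * ∏ t, Λ x ![I t, K t] := by
      intro K
      simp only [hΛ (K _) (I _)]
      rw [Finset.prod_neg]; simp
    have e3 : ∀ m : ℕ, (-1 : ℝ) ^ m * (-1) ^ m = 1 := fun m => by rw [← mul_pow]; simp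
    simp only [sharpF]
    calc _ = (-1) ^ r * (r.factorial : ℝ)⁻¹ * ∑ K : Fin (2 * n - (r + 1) + 1) → Fin (2 * n),
          ∑ A : Fin r → Fin (2 * n), Q A * lc (joinIdx h' A K) * ∏ t, Λ x ![I t, K t] := by
          rw [Finset.mul_sum, Finset.mul_sum]
          refine Finset.sum_congr rfl fun K _ => ?_
          rw [e2, hψ, extd_adjF_apply hr h' ω Λ φ x hφ hd, ← Finset.sum_mul]
          linear_combination ((-1) ^ r * (r.factorial : ℝ)⁻¹ *
            (∑ A : Fin r → Fin (2 * n), Q A * lc (joinIdx h' A K)) * ∏ t, Λ x ![I t, K t]) *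
              e3 (2 * n - (r + 1) + 1)
      _ = _ := by
          rw [mul_assoc _ (mat2 Λ x).det, Finset.mul_sum (a := (mat2 Λ x).det)]
          congr 1
          simp only [mul_left_comm (mat2 Λ x).det, e1]
          simp only [hQT, Finset.sum_mul, Finset.mul_sum]
          rw [Finset.sum_comm]
          simp_rw [Finset.sum_comm (s := (Finset.univ : Finset (Fin (2 * n - (r + 1) + 1) → Fin (2 * n))))]
          rw [Finset.sum_comm]
          refine Finset.sum_congr rfl fun B _ => Finset.sum_congr rfl fun A _ =>
            Finset.sum_congr rfl fun K _ => ?_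
          ring
  have hdeg : 2 * n - (2 * n - (r + 1) + 1) = r + 1 - 1 := by omega
  have h'' : (2 * n - (r + 1) + 1) + (2 * n - (2 * n - (r + 1) + 1)) = 2 * n := by omega
  have h3 : (2 * n - (r + 1) + 1) + r = 2 * n := by omega
  rw [codiffF, castT, dif_pos hdeg, castF, adjF_apply hn h'', ← hψ]
  have hj : ∀ I : Fin (2 * n - (r + 1) + 1) → Fin (2 * n),
      joinIdx h'' I (fun t => J (Fin.cast hdeg t)) = joinIdx h3 I J := by
    intro I; rfl
  simp only [hj, hsharp, lc_join_comm h' h3 (even_two_mul n) (Nat.succ_pos _)]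
  have hfin := sum_lc_mul_lc h' hTalt J
  have e : (-1 : ℝ) ^ r * (-1) ^ r = 1 := by rw [← mul_pow]; simp
  have h4 : ((2 * n - (r + 1) + 1).factorial : ℝ) ≠ 0 := by positivity
  have h5 : (r.factorial : ℝ) ≠ 0 := by positivity
  calc _ = ((2 * n - (r + 1) + 1).factorial : ℝ)⁻¹ * (volF n ω x id * (mat2 Λ x).det *
        (r.factorial : ℝ)⁻¹ * ((-1) ^ r * (-1) ^ r)) * ∑ B, ∑ I,
        T B * lc (joinIdx h' B I) * lc (joinIdx h' J I) := by
        rw [Finset.sum_comm, Finset.mul_sum, Finset.mul_sum]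
        refine Finset.sum_congr rfl fun I _ => ?_
        rw [← Finset.sum_mul]
        ring
    _ = volF n ω x id * (mat2 Λ x).det * T J := by
        rw [hfin, e]
        field_simp

theorem joinIdx_castAdd {α : Type*} {p q : ℕ} (u : Fin p → α) (v : Fin q → α) :
    (fun t => joinIdx (rfl : p + q = p + q) u v (Fin.castAdd q t)) = u := by
  funext t; simp [joinIdx]

theorem joinIdx_natAdd {α : Type*} {p q : ℕ} (u : Fin p → α) (v : Fin q → α) :
    (fun t => joinIdx (rfl : p + q = p + q) u v (Fin.natAdd p t)) = v := by
  funext t; simp [joinIdx]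

/-- `Λ^#` is a homomorphism for the wedge product. -/
theorem sharpF_wedgeF {N p q : ℕ} (Λ : Form N 2) (ω : Form N p) (η : Form N q) :
    sharpF Λ (p + q) (wedgeF p q ω η) = wedgeF p q (sharpF Λ p ω) (sharpF Λ q η) := by
  funext x J
  simp only [sharpF, wedgeF]
  simp only [mul_assoc, Finset.mul_sum, Finset.sum_mul]
  rw [Finset.sum_comm]
  refine Finset.sum_congr rfl fun σ _ => ?_
  rw [← Equiv.sum_comp (Equiv.arrowCongr σ (Equiv.refl (Fin N))),
    ← (joinEquiv (rfl : p + q = p + q)).sum_comp, Fintype.sum_prod_type, Finset.sum_comm]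
  refine Finset.sum_congr rfl fun B _ => Finset.sum_congr rfl fun A _ => ?_
  have h1 : (Equiv.arrowCongr σ (Equiv.refl (Fin N))) (joinEquiv rfl (A, B)) =
      joinIdx rfl A B ∘ σ.symm := by
    funext t; simp [Equiv.arrowCongr, joinEquiv]
  have h2 : ∏ t, Λ x ![joinIdx rfl A B (σ.symm t), J t] =
      (∏ t, Λ x ![A t, J (σ (Fin.castAdd q t))]) * ∏ t, Λ x ![B t, J (σ (Fin.natAdd p t))] := by
    rw [← Equiv.prod_comp σ, Fin.prod_univ_add]
    simp only [Equiv.symm_apply_apply]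
    congr 1 <;> refine Finset.prod_congr rfl fun t _ => ?_ <;> simp [joinIdx]
  rw [h1]
  simp only [Function.comp_apply, Equiv.symm_apply_apply, joinIdx_castAdd, joinIdx_natAdd, h2]
  rw [pow_add]
  ring

theorem sum_fin_succ_arrow {α : Type*} [Fintype α] {r : ℕ} (F : (Fin (r + 1) → α) → ℝ) :
    ∑ I, F I = ∑ a, ∑ A, F (Fin.cons (α := fun _ => α) a A) := by
  rw [← (Fin.consEquiv (fun _ => α)).sum_comp, Fintype.sum_prod_type]
  rfl

theorem sum_fin_one_arrow {α : Type*} [Fintype α] (F : (Fin 1 → α) → ℝ) :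
    ∑ I, F I = ∑ a, F ![a] := by
  rw [sum_fin_succ_arrow]
  refine Finset.sum_congr rfl fun a _ => ?_
  rw [Fintype.sum_unique]
  congr 1

theorem sum_fin_two_arrow {α : Type*} [Fintype α] (F : (Fin 2 → α) → ℝ) :
    ∑ I, F I = ∑ a, ∑ b, F ![a, b] := by
  rw [sum_fin_succ_arrow]
  refine Finset.sum_congr rfl fun a _ => ?_
  rw [sum_fin_one_arrow]
  rfl

theorem sum_fin_three_arrow {α : Type*} [Fintype α] (F : (Fin 3 → α) → ℝ) :
    ∑ I, F I = ∑ a, ∑ b, ∑ c, F ![a, b, c] := by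
  rw [sum_fin_succ_arrow]
  refine Finset.sum_congr rfl fun a _ => ?_
  rw [sum_fin_two_arrow]
  rfl

/-- Expansion of an antisymmetrisation along the first index. -/
theorem sum_sign_succ {α : Type*} {r : ℕ} (F : (Fin (r + 1) → α) → ℝ) (I : Fin (r + 1) → α) :
    ∑ σ : Equiv.Perm (Fin (r + 1)), ((Equiv.Perm.sign σ : ℤ) : ℝ) * F (I ∘ σ) =
      ∑ i, (if i = 0 then 1 else -1) * ∑ τ : Equiv.Perm (Fin r), ((Equiv.Perm.sign τ : ℤ) : ℝ) *
        F (Fin.cons (α := fun _ => α) (I i) ((fun t => I (Equiv.swap 0 i t.succ)) ∘ τ)) := by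
  rw [← Equiv.sum_comp Equiv.Perm.decomposeFin.symm, Fintype.sum_prod_type]
  refine Finset.sum_congr rfl fun i _ => ?_
  rw [Finset.mul_sum]
  refine Finset.sum_congr rfl fun τ _ => ?_
  have h : I ∘ (Equiv.Perm.decomposeFin.symm (i, τ)) =
      Fin.cons (α := fun _ => α) (I i) ((fun t => I (Equiv.swap 0 i t.succ)) ∘ τ) := by
    funext t
    refine Fin.cases ?_ (fun t => ?_) t
    · simp
    · simp
  rw [h, Equiv.Perm.decomposeFin.symm_sign]
  split_ifs <;> simp

theorem sum_sign_two {α : Type*} (F : (Fin 2 → α) → ℝ) (a b : α) :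
    ∑ σ : Equiv.Perm (Fin 2), ((Equiv.Perm.sign σ : ℤ) : ℝ) * F (![a, b] ∘ σ) =
      F ![a, b] - F ![b, a] := by
  rw [sum_sign_succ, Fin.sum_univ_two]
  have h0 : (fun t : Fin 1 => ![a, b] (Equiv.swap 0 0 t.succ)) = ![b] := by
    funext t; fin_cases t; rfl
  have h1 : (fun t : Fin 1 => ![a, b] (Equiv.swap 0 1 t.succ)) = ![a] := by
    funext t; fin_cases t; rfl
  rw [h0, h1, if_pos rfl, if_neg (by decide)]
  simp only [Fintype.sum_unique, one_mul, neg_mul]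
  have e (u v : α) : Fin.cons (α := fun _ => α) u (![v] ∘ (default : Equiv.Perm (Fin 1))) =
      ![u, v] := by
    funext t; fin_cases t <;> rfl
  rw [e, e, Subsingleton.elim (default : Equiv.Perm (Fin 1)) 1, Equiv.Perm.sign_one]
  simp
  rfl

theorem sum_sign_three {α : Type*} (F : (Fin 3 → α) → ℝ) (a b c : α) :
    ∑ σ : Equiv.Perm (Fin 3), ((Equiv.Perm.sign σ : ℤ) : ℝ) * F (![a, b, c] ∘ σ) =
      F ![a, b, c] - F ![a, c, b] - (F ![b, a, c] - F ![b, c, a]) -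
        (F ![c, b, a] - F ![c, a, b]) := by
  rw [sum_sign_succ, Fin.sum_univ_three]
  have h0 : (fun t : Fin 2 => ![a, b, c] (Equiv.swap 0 0 t.succ)) = ![b, c] := by
    funext t; fin_cases t <;> rfl
  have h1 : (fun t : Fin 2 => ![a, b, c] (Equiv.swap 0 1 t.succ)) = ![a, c] := by
    funext t; fin_cases t <;> rfl
  have h2 : (fun t : Fin 2 => ![a, b, c] (Equiv.swap 0 2 t.succ)) = ![b, a] := by
    funext t; fin_cases t <;> rfl
  rw [h0, h1, h2, if_pos rfl, if_neg (by decide), if_neg (by decide)]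
  rw [sum_sign_two fun A => F (Fin.cons (α := fun _ => α) (![a, b, c] 0) A),
    sum_sign_two fun A => F (Fin.cons (α := fun _ => α) (![a, b, c] 1) A),
    sum_sign_two fun A => F (Fin.cons (α := fun _ => α) (![a, b, c] 2) A)]
  simp only [one_mul, neg_mul, ← sub_eq_add_neg]
  rfl

theorem sum_sign_four {α : Type*} (F : (Fin 4 → α) → ℝ) (a b c d : α) :
    ∑ σ : Equiv.Perm (Fin 4), ((Equiv.Perm.sign σ : ℤ) : ℝ) * F (![a, b, c, d] ∘ σ) =
      (F ![a, b, c, d] - F ![a, b, d, c] - (F ![a, c, b, d] - F ![a, c, d, b]) -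
        (F ![a, d, c, b] - F ![a, d, b, c])) -
      (F ![b, a, c, d] - F ![b, a, d, c] - (F ![b, c, a, d] - F ![b, c, d, a]) -
        (F ![b, d, c, a] - F ![b, d, a, c])) -
      (F ![c, b, a, d] - F ![c, b, d, a] - (F ![c, a, b, d] - F ![c, a, d, b]) -
        (F ![c, d, a, b] - F ![c, d, b, a])) -
      (F ![d, b, c, a] - F ![d, b, a, c] - (F ![d, c, b, a] - F ![d, c, a, b]) -
        (F ![d, a, c, b] - F ![d, a, b, c])) := by
  rw [sum_sign_succ, Fin.sum_univ_four]
  have h0 : (fun t : Fin 3 => ![a, b, c, d] (Equiv.swap 0 0 t.succ)) = ![b, c, d] := by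
    funext t; fin_cases t <;> rfl
  have h1 : (fun t : Fin 3 => ![a, b, c, d] (Equiv.swap 0 1 t.succ)) = ![a, c, d] := by
    funext t; fin_cases t <;> rfl
  have h2 : (fun t : Fin 3 => ![a, b, c, d] (Equiv.swap 0 2 t.succ)) = ![b, a, d] := by
    funext t; fin_cases t <;> rfl
  have h3 : (fun t : Fin 3 => ![a, b, c, d] (Equiv.swap 0 3 t.succ)) = ![b, c, a] := by
    funext t; fin_cases t <;> rfl
  rw [h0, h1, h2, h3, if_pos rfl, if_neg (by decide), if_neg (by decide), if_neg (by decide)]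
  rw [sum_sign_three fun A => F (Fin.cons (α := fun _ => α) (![a, b, c, d] 0) A),
    sum_sign_three fun A => F (Fin.cons (α := fun _ => α) (![a, b, c, d] 1) A),
    sum_sign_three fun A => F (Fin.cons (α := fun _ => α) (![a, b, c, d] 2) A),
    sum_sign_three fun A => F (Fin.cons (α := fun _ => α) (![a, b, c, d] 3) A)]
  simp only [one_mul, neg_mul, ← sub_eq_add_neg]
  rfl

theorem eq_vec_two {α : Type*} (I : Fin 2 → α) : I = ![I 0, I 1] := by
  funext t; fin_cases t <;> rfl

theorem eq_vec_three {α : Type*} (I : Fin 3 → α) : I = ![I 0, I 1, I 2] := by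
  funext t; fin_cases t <;> rfl

theorem wedgeF_one_one {N : ℕ} (α β : Form N 1) (x : Pt N) (a b : Fin N) :
    wedgeF 1 1 α β x ![a, b] = α x ![a] * β x ![b] - α x ![b] * β x ![a] := by
  have h := sum_sign_two (fun A : Fin 2 → Fin N => α x ![A 0] * β x ![A 1]) a b
  have e (v : Fin 1 → Fin N) : v = ![v 0] := by funext t; fin_cases t; rfl
  simp only [wedgeF, mul_assoc]
  simp only [e fun i => ![a, b] _]
  refine Eq.trans ?_ h
  norm_num
  rfl

theorem wedgeF_two_one {N : ℕ} {s : Form N 2} (δ : Form N 1) {x : Pt N}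
    (hs : ∀ i j, s x ![i, j] = -s x ![j, i]) (a b c : Fin N) :
    wedgeF 2 1 s δ x ![a, b, c] = s x ![a, b] * δ x ![c] - s x ![a, c] * δ x ![b] +
      s x ![b, c] * δ x ![a] := by
  have h := sum_sign_three (fun A : Fin 3 → Fin N => s x ![A 0, A 1] * δ x ![A 2]) a b c
  have e (v : Fin 1 → Fin N) : v = ![v 0] := by funext t; fin_cases t; rfl
  simp only [wedgeF, mul_assoc]
  have h' : ∑ σ : Equiv.Perm (Fin (2 + 1)), ((Equiv.Perm.sign σ : ℤ) : ℝ) *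
      ((s x fun i => ![a, b, c] (σ (Fin.castAdd 1 i))) *
        (δ x fun j => ![a, b, c] (σ (Fin.natAdd 2 j)))) =
      2 * (s x ![a, b] * δ x ![c] - s x ![a, c] * δ x ![b] + s x ![b, c] * δ x ![a]) := by
    refine Eq.trans (Finset.sum_congr rfl fun σ _ => ?_) (h.trans ?_)
    · rw [eq_vec_two fun i => ![a, b, c] (σ (Fin.castAdd 1 i)), e fun i => ![a, b, c] _]
      rfl
    · simp
      rw [hs b a, hs c a, hs c b]
      ring
  refine (congrArg _ h').trans ?_
  norm_num
  ring

theorem wedgeF_two_two {N : ℕ} {s : Form N 2} {x : Pt N}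
    (hs : ∀ i j, s x ![i, j] = -s x ![j, i]) (a b c d : Fin N) :
    wedgeF 2 2 s s x ![a, b, c, d] = 2 * (s x ![a, b] * s x ![c, d] - s x ![a, c] * s x ![b, d] +
      s x ![a, d] * s x ![b, c]) := by
  have h := sum_sign_four (fun A : Fin 4 → Fin N => s x ![A 0, A 1] * s x ![A 2, A 3]) a b c d
  simp only [wedgeF, mul_assoc]
  have h' : ∑ σ : Equiv.Perm (Fin (2 + 2)), ((Equiv.Perm.sign σ : ℤ) : ℝ) *
      ((s x fun i => ![a, b, c, d] (σ (Fin.castAdd 2 i))) *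
        (s x fun j => ![a, b, c, d] (σ (Fin.natAdd 2 j)))) =
      8 * (s x ![a, b] * s x ![c, d] - s x ![a, c] * s x ![b, d] + s x ![a, d] * s x ![b, c]) := by
    refine Eq.trans (Finset.sum_congr rfl fun σ _ => ?_) (h.trans ?_)
    · rw [eq_vec_two fun i => ![a, b, c, d] (σ (Fin.castAdd 2 i)),
        eq_vec_two fun i => ![a, b, c, d] (σ (Fin.natAdd 2 i))]
      rfl
    · simp
      rw [hs b a, hs c a, hs c b, hs d a, hs d b, hs d c]
      ring
  refine (congrArg _ h').trans ?_
  norm_num [Nat.factorial]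
  ring

theorem differentiableAt_wedgeF {N p q : ℕ} {ω : Form N p} {η : Form N q} {x : Pt N}
    (hω : ∀ I, DifferentiableAt ℝ (fun y => ω y I) x)
    (hη : ∀ I, DifferentiableAt ℝ (fun y => η y I) x) (I : Fin (p + q) → Fin N) :
    DifferentiableAt ℝ (fun y => wedgeF p q ω η y I) x := by
  unfold wedgeF
  fun_prop

theorem differentiableAt_volF {N n : ℕ} {ω : Form N 2} {x : Pt N}
    (hω : ∀ I, DifferentiableAt ℝ (fun y => ω y I) x) (I : Fin (2 * n) → Fin N) :
    DifferentiableAt ℝ (fun y => volF n ω y I) x := by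
  have h (m : ℕ) : ∀ I, DifferentiableAt ℝ (fun y => wpow ω m y I) x := by
    induction m with
    | zero => intro I; exact differentiableAt_const _
    | succ m ih => exact differentiableAt_wedgeF ih hω
  exact (h n I).const_mul _

theorem differentiableAt_sharpF {N p : ℕ} {Λ : Form N 2} {ω : Form N p} {x : Pt N}
    (hΛ : ∀ I, DifferentiableAt ℝ (fun y => Λ y I) x)
    (hω : ∀ I, DifferentiableAt ℝ (fun y => ω y I) x) (I : Fin p → Fin N) :
    DifferentiableAt ℝ (fun y => sharpF Λ p ω y I) x := by
  unfold sharpF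
  refine DifferentiableAt.const_mul (DifferentiableAt.fun_sum fun J _ => ?_) _
  exact (hω J).mul (by fun_prop)

theorem contDiffOn_pd {N : ℕ} {f : Pt N → ℝ} {M : Set (Pt N)} (hM : IsOpen M)
    (hf : ContDiffOn ℝ (⊤ : ℕ∞) f M) (i : Fin N) : ContDiffOn ℝ (⊤ : ℕ∞) (pd f i) M := by
  have h := hf.fderiv_of_isOpen hM (m := (⊤ : ℕ∞)) (by simp)
  exact h.clm_apply contDiffOn_const

theorem pd_comm {N : ℕ} {f : Pt N → ℝ} {M : Set (Pt N)} (hM : IsOpen M)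
    (hf : ContDiffOn ℝ (⊤ : ℕ∞) f M) {x : Pt N} (hx : x ∈ M) (a b : Fin N) :
    pd (pd f a) b x = pd (pd f b) a x := by
  have hfx : ContDiffAt ℝ (⊤ : ℕ∞) f x := hf.contDiffAt (hM.mem_nhds hx)
  have hs : IsSymmSndFDerivAt ℝ f x := hfx.isSymmSndFDerivAt (by
    rw [minSmoothness_of_isRCLikeNormedField]; exact WithTop.coe_le_coe.2 le_top)
  have hd : DifferentiableAt ℝ (fderiv ℝ f) x :=
    ((hf.fderiv_of_isOpen hM (m := (⊤ : ℕ∞)) (by simp)).contDiffAt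
      (hM.mem_nhds hx)).differentiableAt (by simp)
  have h (u v : Pt N) : fderiv ℝ (fun y => fderiv ℝ f y u) x v =
      fderiv ℝ (fderiv ℝ f) x v u := by
    rw [fderiv_clm_apply hd (differentiableAt_const u)]
    simp
  exact (h _ _).trans ((hs _ _).trans (h _ _).symm)

theorem matrix_rank_add_le {ι κ : Type*} [Fintype ι] [Fintype κ] (A B : Matrix ι κ ℝ) :
    (A + B).rank ≤ A.rank + B.rank := by
  classical
  unfold Matrix.rank
  rw [Matrix.mulVecLin_add]
  refine le_trans (Submodule.finrank_mono ?_)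
    (Submodule.finrank_add_le_finrank_add_finrank _ _)
  rintro _ ⟨v, rfl⟩
  exact Submodule.add_mem_sup ⟨v, rfl⟩ ⟨v, rfl⟩

section DiracMatrix

variable {ι κ : Type*} [Fintype ι] [Fintype κ]
  {Ω Λ : Matrix ι ι ℝ} {G : Matrix κ ι ℝ} {C : Matrix κ κ ℝ}

open Matrix

theorem dirac_antisymm [DecidableEq κ] (hΛ : Λᵀ = -Λ) (hB : (G * Λ * Gᵀ) * C = 1) : Cᵀ = -C := by
  have h1 : (G * Λ * Gᵀ)ᵀ = -(G * Λ * Gᵀ) := by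
    simp [Matrix.transpose_mul, hΛ, Matrix.mul_assoc]
  have h2 : Cᵀ * -(G * Λ * Gᵀ) = 1 := by
    rw [← h1, ← Matrix.transpose_mul, hB, Matrix.transpose_one]
  calc Cᵀ = Cᵀ * ((G * Λ * Gᵀ) * C) := by rw [hB, Matrix.mul_one]
    _ = -((Cᵀ * -(G * Λ * Gᵀ)) * C) := by simp [Matrix.mul_assoc]
    _ = -C := by rw [h2, Matrix.one_mul]

theorem dirac_mul_eq_zero [DecidableEq ι] [DecidableEq κ] (hΩ : Ω * Λ = -1) (hB : (G * Λ * Gᵀ) * C = 1) :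
    (G * Λ) * (Ω + Gᵀ * C * G) = 0 := by
  have hΩ' : Λ * Ω = -1 := by
    have h : (-Λ) * Ω = 1 := by
      rw [mul_eq_one_comm]; simp [hΩ]
    rw [← h]; simp
  calc (G * Λ) * (Ω + Gᵀ * C * G) = G * (Λ * Ω) + ((G * Λ * Gᵀ) * C) * G := by
        simp only [Matrix.mul_add, Matrix.mul_assoc]
    _ = 0 := by rw [hΩ', hB]; simp

theorem dirac_rank [DecidableEq ι] [DecidableEq κ] (hΩ : Ω * Λ = -1) (hB : (G * Λ * Gᵀ) * C = 1)
    (hG : LinearIndependent ℝ G.row) :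
    (Ω + Gᵀ * C * G).rank + Fintype.card κ = Fintype.card ι := by
  have hΛ1 : (-Ω) * Λ = 1 := by simp [hΩ]
  have hΛu : IsUnit Λ := (Matrix.isUnit_iff_isUnit_det _).2
    (Matrix.isUnit_det_of_left_inverse hΛ1)
  have hΩu : IsUnit Ω := (Matrix.isUnit_iff_isUnit_det _).2
    (Matrix.isUnit_det_of_right_inverse (B := -Λ) (by simp [hΩ]))
  have hGr : (G * Λ).rank = Fintype.card κ := by
    rw [Matrix.rank_mul_eq_left_of_isUnit_det _ _ ((Matrix.isUnit_iff_isUnit_det _).1 hΛu)]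
    exact hG.rank_matrix
  have h1 := Matrix.rank_add_rank_le_card_of_mul_eq_zero (dirac_mul_eq_zero hΩ hB)
  have h2 : Ω.rank ≤ (Ω + Gᵀ * C * G).rank + (-(Gᵀ * C * G)).rank := by
    have := matrix_rank_add_le (Ω + Gᵀ * C * G) (-(Gᵀ * C * G))
    simpa using this
  have h3 : (-(Gᵀ * C * G)).rank ≤ Fintype.card κ := by
    rw [← Matrix.mul_neg]
    exact (Matrix.rank_mul_le_left _ _).trans (Matrix.rank_le_card_width _)
  have h4 : Ω.rank = Fintype.card ι := Matrix.rank_of_isUnit _ hΩu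
  omega

theorem dirac_trace [DecidableEq ι] [DecidableEq κ] (hΩ : Ω * Λ = -1) (hB : (G * Λ * Gᵀ) * C = 1) :
    ((Ω + Gᵀ * C * G) * Λ).trace = Fintype.card κ - Fintype.card ι := by
  have h : (Gᵀ * C * G * Λ).trace = ((G * Λ * Gᵀ) * C).trace := by
    rw [Matrix.mul_assoc, Matrix.trace_mul_comm, ← Matrix.mul_assoc]
  rw [Matrix.add_mul, Matrix.trace_add, h, hB, hΩ]
  simp
  ring

theorem dirac_sharp [DecidableEq ι] (hΩ : Ω * Λ = -1) (hΛ : Λᵀ = -Λ) :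
    Λᵀ * (Ω + Gᵀ * C * G) * Λ = Λ - Λ * Gᵀ * C * (G * Λ) := by
  rw [hΛ, Matrix.mul_add, Matrix.add_mul, Matrix.mul_assoc, hΩ]
  simp [Matrix.mul_assoc]
  abel

end DiracMatrix

section DiracJacobi

variable {ι κ : Type*} [Fintype ι] [Fintype κ]

open Matrix

theorem sum_cyclic_eq_zero {dΩ : ι → Matrix ι ι ℝ}
    (hdΩ : ∀ a e f, dΩ a e f + dΩ e f a + dΩ f a e = 0) (u v w : ι → ℝ) :
    (∑ a, ∑ e, ∑ f, u a * v e * w f * dΩ a e f) + (∑ a, ∑ e, ∑ f, v a * w e * u f * dΩ a e f) +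
      (∑ a, ∑ e, ∑ f, w a * u e * v f * dΩ a e f) = 0 := by
  have h1 : ∑ a, ∑ e, ∑ f, v a * w e * u f * dΩ a e f =
      ∑ a, ∑ e, ∑ f, u a * v e * w f * dΩ e f a := by
    rw [Finset.sum_comm' (t' := Finset.univ) (s' := fun _ => Finset.univ) (by simp)]
    rw [Finset.sum_congr rfl fun e _ => Finset.sum_comm, Finset.sum_comm]
    refine Finset.sum_congr rfl fun a _ => ?_
    rw [Finset.sum_comm]
    refine Finset.sum_congr rfl fun e _ => Finset.sum_congr rfl fun f _ => by ring
  have h2 : ∑ a, ∑ e, ∑ f, w a * u e * v f * dΩ a e f =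
      ∑ a, ∑ e, ∑ f, u a * v e * w f * dΩ f a e := by
    rw [Finset.sum_comm]
    refine Finset.sum_congr rfl fun a _ => ?_
    rw [Finset.sum_comm]
    refine Finset.sum_congr rfl fun e _ => Finset.sum_congr rfl fun f _ => by ring
  rw [h1, h2]
  simp only [← Finset.sum_add_distrib, ← mul_add, hdΩ, mul_zero, Finset.sum_const_zero]

theorem jacobi_of_deriv_eq {P : Matrix ι ι ℝ} {dP dΩ : ι → Matrix ι ι ℝ} {K : Matrix ι κ ℝ}
    {H : ι → Matrix κ ι ℝ} (hP : ∀ a b, P a b = -P b a) (hH : ∀ a e i, H a i e = H e i a)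
    (hdΩ : ∀ a e f, dΩ a e f + dΩ e f a + dΩ f a e = 0)
    (h : ∀ a, dP a = P * dΩ a * P - P * (H a)ᵀ * Kᵀ - K * H a * P) (b c d : ι) :
    ∑ a, (P a b * dP a c d + P a c * dP a d b + P a d * dP a b c) = 0 := by
  let T (i : κ) (b c : ι) : ℝ := ∑ a, ∑ e, P a b * H a i e * P e c
  have hT (i : κ) (b c : ι) : T i b c = T i c b := by
    rw [show T i c b = ∑ a, ∑ e, P a c * H a i e * P e b from rfl, Finset.sum_comm]
    show ∑ a, ∑ e, P a b * H a i e * P e c = _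
    refine Finset.sum_congr rfl fun a _ => Finset.sum_congr rfl fun e _ => ?_
    rw [hH a e i, hP a b, hP b a]
    ring
  let U (b c d : ι) : ℝ := ∑ a, ∑ e, ∑ f, P a b * P e c * P f d * dΩ a e f
  have key (b c d : ι) : ∑ a, P a b * dP a c d =
      -U b c d + ∑ i, K d i * T i b c - ∑ i, K c i * T i b d := by
    have e1 : ∑ a, P a b * (P * dΩ a * P) c d = -U b c d := by
      simp only [U, ← Finset.sum_neg_distrib]
      refine Finset.sum_congr rfl fun a _ => ?_
      simp only [Matrix.mul_apply, Finset.mul_sum, Finset.sum_mul]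
      rw [Finset.sum_comm]
      refine Finset.sum_congr rfl fun e _ => Finset.sum_congr rfl fun f _ => ?_
      rw [hP c e]; ring
    have e2 : ∑ a, P a b * (P * (H a)ᵀ * Kᵀ) c d = -∑ i, K d i * T i b c := by
      simp only [T, ← Finset.sum_neg_distrib, Finset.mul_sum]
      rw [Finset.sum_comm]
      refine Finset.sum_congr rfl fun a _ => ?_
      simp only [Matrix.mul_apply, Matrix.transpose_apply, Finset.mul_sum, Finset.sum_mul]
      refine Finset.sum_congr rfl fun i _ => Finset.sum_congr rfl fun e _ => ?_
      rw [hP c e]; ring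
    have e3 : ∑ a, P a b * (K * H a * P) c d = ∑ i, K c i * T i b d := by
      simp only [T, Finset.mul_sum]
      rw [Finset.sum_comm]
      refine Finset.sum_congr rfl fun a _ => ?_
      simp only [Matrix.mul_apply, Finset.mul_sum, Finset.sum_mul]
      rw [Finset.sum_comm]
      refine Finset.sum_congr rfl fun i _ => Finset.sum_congr rfl fun e _ => ?_
      ring
    simp only [h, Matrix.sub_apply, mul_sub, Finset.sum_sub_distrib, e1, e2, e3]
    ring
  have hU : U b c d + U c d b + U d b c = 0 := sum_cyclic_eq_zero hdΩ _ _ _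
  have hTT : ∀ i, T i b c = T i c b ∧ T i b d = T i d b ∧ T i c d = T i d c :=
    fun i => ⟨hT _ _ _, hT _ _ _, hT _ _ _⟩
  rw [Finset.sum_add_distrib, Finset.sum_add_distrib, key, key, key]
  simp only [fun i => (hTT i).1, fun i => (hTT i).2.1, fun i => (hTT i).2.2]
  linarith

/-- The derivative of a family `P` with `PΩP = -P`, `GP = 0` and `1 + PΩ = KG`. -/
theorem deriv_eq_of_dirac [DecidableEq ι] {P dP Ω dΩ : Matrix ι ι ℝ} {K : Matrix ι κ ℝ}
    {G H : Matrix κ ι ℝ} (hP : Pᵀ = -P) (hdP : dPᵀ = -dP) (hΩ : Ωᵀ = -Ω)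
    (hK : P * Ω = K * G - 1) (h1 : dP * Ω * P + P * dΩ * P + P * Ω * dP = -dP)
    (h2 : H * P + G * dP = 0) : dP = P * dΩ * P - P * Hᵀ * Kᵀ - K * H * P := by
  have hK' : Ω * P = Gᵀ * Kᵀ - 1 := by
    have := congrArg Matrix.transpose hK
    simpa [Matrix.transpose_mul, hP, hΩ] using this
  have h2' : dP * Gᵀ = -(P * Hᵀ) := by
    have := congrArg Matrix.transpose h2
    simp only [Matrix.transpose_add, Matrix.transpose_mul, hP, hdP, Matrix.neg_mul,
      Matrix.transpose_zero] at this
    rw [← sub_eq_zero, ← neg_eq_zero, ← this]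
    abel
  have h3 : G * dP = -(H * P) := by
    rw [← sub_eq_zero, ← h2]; abel
  have e1 : dP * Ω * P = -(P * Hᵀ * Kᵀ) - dP := by
    rw [Matrix.mul_assoc, hK', Matrix.mul_sub, ← Matrix.mul_assoc, h2']
    simp
  have e2 : P * Ω * dP = -(K * H * P) - dP := by
    rw [hK, Matrix.sub_mul, Matrix.mul_assoc, h3]
    simp [Matrix.mul_assoc]
  rw [e1, e2] at h1
  have : dP = -dP + dP + dP := by abel
  rw [this, ← h1]
  abel

end DiracJacobi

theorem sum_three_mul {ι : Type*} [Fintype ι] (u v w Q : ι → ℝ) (P : ι → ι → ℝ) :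
    ∑ b, ∑ c, ∑ d, u b * v c * w d * (Q b * P c d - Q c * P b d + Q d * P b c) =
      (∑ b, u b * Q b) * (∑ c, ∑ d, v c * w d * P c d) -
        (∑ c, v c * Q c) * (∑ b, ∑ d, u b * w d * P b d) +
        (∑ d, w d * Q d) * (∑ b, ∑ c, u b * v c * P b c) := by
  have e1 : (∑ b, u b * Q b) * (∑ c, ∑ d, v c * w d * P c d) =
      ∑ b, ∑ c, ∑ d, u b * v c * w d * (Q b * P c d) := by
    rw [Finset.sum_mul]
    simp only [Finset.mul_sum]
    refine Finset.sum_congr rfl fun b _ => Finset.sum_congr rfl fun c _ =>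
      Finset.sum_congr rfl fun d _ => by ring
  have e2 : (∑ c, v c * Q c) * (∑ b, ∑ d, u b * w d * P b d) =
      ∑ b, ∑ c, ∑ d, u b * v c * w d * (Q c * P b d) := by
    symm
    rw [Finset.sum_comm, Finset.sum_mul]
    simp only [Finset.mul_sum]
    refine Finset.sum_congr rfl fun b _ => Finset.sum_congr rfl fun c _ =>
      Finset.sum_congr rfl fun d _ => by ring
  have e3 : (∑ d, w d * Q d) * (∑ b, ∑ c, u b * v c * P b c) =
      ∑ b, ∑ c, ∑ d, u b * v c * w d * (Q d * P b c) := by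
    symm
    refine (Finset.sum_congr rfl fun b _ => Finset.sum_comm).trans ?_
    rw [Finset.sum_comm, Finset.sum_mul]
    simp only [Finset.mul_sum]
    refine Finset.sum_congr rfl fun b _ => Finset.sum_congr rfl fun c _ =>
      Finset.sum_congr rfl fun d _ => by ring
  rw [e1, e2, e3]
  simp only [← Finset.sum_add_distrib, ← Finset.sum_sub_distrib]
  refine Finset.sum_congr rfl fun a _ => Finset.sum_congr rfl fun b _ =>
    Finset.sum_congr rfl fun c _ => by ring

theorem pd_mul {N : ℕ} {f g : Pt N → ℝ} {x : Pt N} (hf : DifferentiableAt ℝ f x)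
    (hg : DifferentiableAt ℝ g x) (a : Fin N) :
    pd (fun y => f y * g y) a x = pd f a x * g x + f x * pd g a x := by
  unfold pd
  rw [fderiv_fun_mul hf hg]
  simp
  ring

theorem pd_congr {N : ℕ} {f g : Pt N → ℝ} {x : Pt N} (h : f =ᶠ[nhds x] g) (a : Fin N) :
    pd f a x = pd g a x := by
  unfold pd
  rw [h.fderiv_eq]

theorem Alt.swap_two {N : ℕ} {f : (Fin 2 → Fin N) → ℝ} (hf : Alt f) (a b : Fin N) :
    f ![a, b] = -f ![b, a] := by
  have h := hf ![b, a] (Equiv.swap 0 1)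
  have e : ![b, a] ∘ (Equiv.swap 0 1 : Equiv.Perm (Fin 2)) = ![a, b] := by
    funext t; fin_cases t <;> rfl
  rw [e] at h
  simpa using h

/-- The compatibility condition at a point, for a form whose dual bivector satisfies the
Jacobi identity there. -/
theorem codiffF_wedgeF_of_jacobi {n : ℕ} (hn : 2 ≤ n) {ω Λ σ : Form (2 * n) 2} {x : Pt (2 * n)}
    (hσ : ∀ᶠ y in nhds x, Alt (σ y)) (hΛ : ∀ i j, Λ x ![i, j] = -Λ x ![j, i])
    (hωΛ : (mat2 Λ x).transpose * mat2 ω x = 1)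
    (dω : ∀ I, DifferentiableAt ℝ (fun y => ω y I) x)
    (dΛ : ∀ I, DifferentiableAt ℝ (fun y => Λ y I) x)
    (dσ : ∀ I, DifferentiableAt ℝ (fun y => σ y I) x)
    (hωP : ∀ i j, ∑ b, ∑ c, ω x ![i, b] * ω x ![j, c] * sharpF Λ 2 σ x ![b, c] = σ x ![i, j])
    (hJ : ∀ b c d, ∑ a, (sharpF Λ 2 σ x ![a, b] * pd (fun y => sharpF Λ 2 σ y ![c, d]) a x +
      sharpF Λ 2 σ x ![a, c] * pd (fun y => sharpF Λ 2 σ y ![d, b]) a x +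
      sharpF Λ 2 σ x ![a, d] * pd (fun y => sharpF Λ 2 σ y ![b, c]) a x) = 0)
    (I : Fin 3 → Fin (2 * n)) :
    smulF 2 (wedgeF 2 1 σ (codiffF ω Λ 2 σ)) x I = codiffF ω Λ 4 (wedgeF 2 2 σ σ) x I := by
  set P := sharpF Λ 2 σ with hPdef
  have dP : ∀ I, DifferentiableAt ℝ (fun y => P y I) x := differentiableAt_sharpF dΛ dσ
  have dρ : DifferentiableAt ℝ (fun y => volF n ω y id) x := differentiableAt_volF dω id
  have hP : ∀ᶠ y in nhds x, ∀ i j, P y ![i, j] = -P y ![j, i] := by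
    filter_upwards [hσ] with y hy i j
    exact (alt_sharpF Λ hy).swap_two i j
  let Q (b : Fin (2 * n)) : ℝ := ∑ a, pd (fun y => volF n ω y id * P y ![a, b]) a x
  have D2 (j : Fin (2 * n)) : codiffF ω Λ 2 σ x ![j] =
      volF n ω x id * (mat2 Λ x).det * ∑ b, ω x ![j, b] * Q b := by
    have h := codiffF_apply (r := 1) (by omega) ω Λ σ x hσ hΛ hωΛ
      (fun I => dρ.mul (dP I)) ![j]
    rw [sum_fin_one_arrow] at h
    simp only [Fin.prod_univ_one] at h
    exact h
  have hW (y : Pt (2 * n)) (hy : ∀ i j, P y ![i, j] = -P y ![j, i]) (a b c d : Fin (2 * n)) :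
      volF n ω y id * sharpF Λ 4 (wedgeF 2 2 σ σ) y ![a, b, c, d] =
      2 * ((volF n ω y id * P y ![a, b]) * P y ![c, d] -
        (volF n ω y id * P y ![a, c]) * P y ![b, d] +
        (volF n ω y id * P y ![a, d]) * P y ![b, c]) := by
    have e : sharpF Λ 4 (wedgeF 2 2 σ σ) = wedgeF 2 2 P P := sharpF_wedgeF (p := 2) (q := 2) Λ σ σ
    rw [e]
    refine (congrArg _ (wedgeF_two_two hy a b c d)).trans ?_
    ring
  have hdiv (b c d : Fin (2 * n)) :
      ∑ a, pd (fun y => volF n ω y id * sharpF Λ 4 (wedgeF 2 2 σ σ) y ![a, b, c, d]) a x =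
      2 * (Q b * P x ![c, d] - Q c * P x ![b, d] + Q d * P x ![b, c]) := by
    have e (a : Fin (2 * n)) :
        pd (fun y => volF n ω y id * sharpF Λ 4 (wedgeF 2 2 σ σ) y ![a, b, c, d]) a x =
        2 * (pd (fun y => volF n ω y id * P y ![a, b]) a x * P x ![c, d] -
          pd (fun y => volF n ω y id * P y ![a, c]) a x * P x ![b, d] +
          pd (fun y => volF n ω y id * P y ![a, d]) a x * P x ![b, c]) +
        2 * volF n ω x id * (P x ![a, b] * pd (fun y => P y ![c, d]) a x +
          P x ![a, c] * pd (fun y => P y ![d, b]) a x +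
          P x ![a, d] * pd (fun y => P y ![b, c]) a x) := by
      have e1 : pd (fun y => volF n ω y id * sharpF Λ 4 (wedgeF 2 2 σ σ) y ![a, b, c, d]) a x =
          pd (fun y => 2 * ((volF n ω y id * P y ![a, b]) * P y ![c, d] +
            (volF n ω y id * P y ![a, c]) * P y ![d, b] +
            (volF n ω y id * P y ![a, d]) * P y ![b, c])) a x := by
        refine pd_congr ?_ a
        filter_upwards [hP] with y hy
        rw [hW y hy, hy d b]
        ring
      rw [e1, pd_mul (by fun_prop) (by fun_prop)]
      have e2 : pd (fun y => (volF n ω y id * P y ![a, b]) * P y ![c, d] +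
            (volF n ω y id * P y ![a, c]) * P y ![d, b] +
            (volF n ω y id * P y ![a, d]) * P y ![b, c]) a x =
          pd (fun y => (volF n ω y id * P y ![a, b]) * P y ![c, d]) a x +
          pd (fun y => (volF n ω y id * P y ![a, c]) * P y ![d, b]) a x +
          pd (fun y => (volF n ω y id * P y ![a, d]) * P y ![b, c]) a x := by
        unfold pd
        rw [fderiv_fun_add (by fun_prop) (by fun_prop), fderiv_fun_add (by fun_prop) (by fun_prop)]
        rfl
      have e3 (I J) : pd (fun y => (volF n ω y id * P y I) * P y J) a x =
          pd (fun y => volF n ω y id * P y I) a x * P x J +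
            volF n ω x id * P x I * pd (fun y => P y J) a x :=
        pd_mul (dρ.mul (dP I)) (dP J) a
      have e4 : pd (fun _ => (2 : ℝ)) a x = 0 := by simp [pd]
      rw [e2, e3, e3, e3, e4, hP.self_of_nhds d b]
      ring
    simp only [e, Finset.sum_add_distrib, ← Finset.mul_sum] at hJ ⊢
    rw [hJ]
    simp only [Finset.sum_sub_distrib, ← Finset.sum_mul, Q]
    ring
  have D4 (i j k : Fin (2 * n)) : codiffF ω Λ 4 (wedgeF 2 2 σ σ) x ![i, j, k] =
      volF n ω x id * (mat2 Λ x).det * ∑ b, ∑ c, ∑ d, ω x ![i, b] * ω x ![j, c] * ω x ![k, d] *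
        (2 * (Q b * P x ![c, d] - Q c * P x ![b, d] + Q d * P x ![b, c])) := by
    have h := codiffF_apply (r := 3) (by omega) ω Λ (wedgeF 2 2 σ σ) x
      (Filter.Eventually.of_forall fun y => alt_wedgeF σ σ y) hΛ hωΛ
      (fun I => dρ.mul (differentiableAt_sharpF dΛ (differentiableAt_wedgeF dσ dσ) I)) ![i, j, k]
    rw [sum_fin_three_arrow] at h
    simp only [Fin.prod_univ_three] at h
    refine h.trans ?_
    refine congrArg _ (Finset.sum_congr rfl fun b _ => Finset.sum_congr rfl fun c _ =>
      Finset.sum_congr rfl fun d _ => ?_)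
    rw [← hdiv]
    rfl
  rw [eq_vec_three I, D4]
  change 2 * wedgeF 2 1 σ (codiffF ω Λ 2 σ) x ![I 0, I 1, I 2] = _
  rw [wedgeF_two_one _ fun i j => hσ.self_of_nhds.swap_two i j, D2, D2, D2]
  simp only [mul_left_comm _ (2 : ℝ), ← Finset.mul_sum]
  rw [sum_three_mul (fun b => ω x ![I 0, b]) (fun b => ω x ![I 1, b]) (fun b => ω x ![I 2, b]) Q
    fun a b => P x ![a, b], hωP, hωP, hωP]
  ring

/-- Entrywise partial derivative of a matrix-valued function. -/
def pdM {N : ℕ} {ι κ : Type*} (A : Pt N → Matrix ι κ ℝ) (a : Fin N) (x : Pt N) : Matrix ι κ ℝ :=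
  Matrix.of fun i j => pd (fun y => A y i j) a x

theorem pdM_congr {N : ℕ} {ι κ : Type*} {A B : Pt N → Matrix ι κ ℝ} {x : Pt N}
    (h : A =ᶠ[nhds x] B) (a : Fin N) : pdM A a x = pdM B a x := by
  ext i j
  exact pd_congr (h.mono fun y hy => by simp only [hy]) a

theorem pdM_neg {N : ℕ} {ι κ : Type*} (A : Pt N → Matrix ι κ ℝ) (a : Fin N) (x : Pt N) :
    pdM (fun y => -A y) a x = -pdM A a x := by
  ext i j
  simp [pdM, pd]

theorem pdM_mul {N : ℕ} {ι κ μ : Type*} [Fintype κ] {A : Pt N → Matrix ι κ ℝ}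
    {B : Pt N → Matrix κ μ ℝ} {x : Pt N} (hA : ∀ i j, DifferentiableAt ℝ (fun y => A y i j) x)
    (hB : ∀ i j, DifferentiableAt ℝ (fun y => B y i j) x) (a : Fin N) :
    pdM (fun y => A y * B y) a x = pdM A a x * B x + A x * pdM B a x := by
  ext i j
  have h : pd (fun y => ∑ l, A y i l * B y l j) a x =
      ∑ l, pd (fun y => A y i l * B y l j) a x := by
    unfold pd
    rw [fderiv_fun_sum fun l _ => (hA i l).fun_mul (hB l j)]
    simp
  simp only [pdM, Matrix.add_apply, Matrix.mul_apply, Matrix.of_apply, h,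
    ← Finset.sum_add_distrib]
  exact Finset.sum_congr rfl fun l _ => pd_mul (hA i l) (hB l j) a

theorem differentiableAt_matrix_mul {N : ℕ} {ι κ μ : Type*} [Fintype κ]
    {A : Pt N → Matrix ι κ ℝ} {B : Pt N → Matrix κ μ ℝ} {x : Pt N}
    (hA : ∀ i j, DifferentiableAt ℝ (fun y => A y i j) x)
    (hB : ∀ i j, DifferentiableAt ℝ (fun y => B y i j) x) (i : ι) (j : μ) :
    DifferentiableAt ℝ (fun y => (A y * B y) i j) x := by
  simp only [Matrix.mul_apply]
  fun_prop

theorem sum_lt_antisymm {m : ℕ} (t : Fin m → Fin m → ℝ) (ht : ∀ i, t i i = 0) :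
    ∑ i, ∑ j, (if i < j then t i j + t j i else 0) = ∑ i, ∑ j, t i j := by
  have h : ∑ i, ∑ j, t i j = ∑ i, ∑ j, ((if i < j then t i j else 0) +
      (if j < i then t i j else 0)) := by
    refine Finset.sum_congr rfl fun i _ => Finset.sum_congr rfl fun j _ => ?_
    rcases lt_trichotomy i j with h | h | h
    · simp [h, h.le]
    · simp [h, ht]
    · simp [h, h.le]
  simp only [h, Finset.sum_add_distrib]
  rw [Finset.sum_comm (f := fun i j => if j < i then t i j else 0)]
  simp only [← Finset.sum_add_distrib]
  refine Finset.sum_congr rfl fun i _ => Finset.sum_congr rfl fun j _ => ?_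
  split_ifs <;> simp

/-- The Jacobian matrix of a family of functions. -/
def jac {N m : ℕ} (f : Fin m → Pt N → ℝ) (x : Pt N) : Matrix (Fin m) (Fin N) ℝ :=
  Matrix.of fun i a => pd (f i) a x

theorem braF_eq_mul {N m : ℕ} (Λ : Form N 2) (f : Fin m → Pt N → ℝ) (x : Pt N) :
    (Matrix.of fun i j => braF Λ (f i) (f j) x) = jac f x * mat2 Λ x * (jac f x).transpose := by
  ext i j
  simp only [braF, jac, mat2, Matrix.mul_apply, Matrix.of_apply, Matrix.transpose_apply,
    Finset.sum_mul]
  rw [Finset.sum_comm]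
  exact Finset.sum_congr rfl fun a _ => Finset.sum_congr rfl fun b _ => by ring

theorem mat2_sigmaDirac {n m : ℕ} (ω₀ : Form (2 * n) 2) (f : Fin m → Pt (2 * n) → ℝ)
    (c : Fin m → Fin m → Pt (2 * n) → ℝ) (x : Pt (2 * n))
    (hc : (Matrix.of fun i j => c i j x).transpose = -Matrix.of fun i j => c i j x) :
    mat2 (sigmaDirac m ω₀ f c) x =
      mat2 ω₀ x + (jac f x).transpose * (Matrix.of fun i j => c i j x) * jac f x := by
  have hc' (i j : Fin m) : c i j x = -c j i x := congrFun (congrFun hc j) i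
  ext a b
  have h := sum_lt_antisymm (fun i j => c i j x * (pd (f i) a x * pd (f j) b x))
    (fun i => by
      have := hc' i i
      have h0 : c i i x = 0 := by linarith
      simp [h0])
  have e : ∑ i, ∑ j, (if i < j then c i j x * wedgeF 1 1 (dF (f i)) (dF (f j)) x ![a, b] else 0) =
      ∑ i, ∑ j, c i j x * (pd (f i) a x * pd (f j) b x) := by
    rw [← h]
    refine Finset.sum_congr rfl fun i _ => Finset.sum_congr rfl fun j _ => ?_
    rw [wedgeF_one_one, hc' j i]
    simp only [dF, Matrix.cons_val_zero]
    split_ifs <;> ring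
  simp only [sigmaDirac, addF, mat2, Matrix.of_apply, Matrix.add_apply, Matrix.mul_apply,
    Matrix.transpose_apply, jac, Finset.sum_mul] at e ⊢
  rw [e, Finset.sum_comm]
  refine congrArg _ (Finset.sum_congr rfl fun i _ => Finset.sum_congr rfl fun j _ => by ring)

theorem alt_sigmaDirac {n m : ℕ} {ω₀ : Form (2 * n) 2} (f : Fin m → Pt (2 * n) → ℝ)
    (c : Fin m → Fin m → Pt (2 * n) → ℝ) {x : Pt (2 * n)} (h : Alt (ω₀ x)) :
    Alt (sigmaDirac m ω₀ f c x) := by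
  intro I τ
  simp only [sigmaDirac, addF, h I τ, mul_add, Finset.mul_sum]
  refine congrArg _ (Finset.sum_congr rfl fun i _ => Finset.sum_congr rfl fun j _ => ?_)
  split_ifs
  · have h := alt_wedgeF (dF (f i)) (dF (f j)) x I τ
    exact (congrArg _ h).trans (mul_left_comm _ _ _)
  · simp

theorem mat2_sharpF {N : ℕ} (Λ σ : Form N 2) (x : Pt N) :
    mat2 (sharpF Λ 2 σ) x = (mat2 Λ x).transpose * mat2 σ x * mat2 Λ x := by
  ext a b
  simp only [mat2, sharpF, Matrix.of_apply, Matrix.mul_apply, Matrix.transpose_apply,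
    sum_fin_two_arrow, Fin.prod_univ_two, Finset.sum_mul]
  rw [Finset.sum_comm]
  simp
  exact Finset.sum_congr rfl fun i _ => Finset.sum_congr rfl fun j _ => by ring

theorem extd_two_apply {N : ℕ} (ω : Form N 2) (x : Pt N) (a e f : Fin N) :
    extd ω x ![a, e, f] = pd (fun y => ω y ![e, f]) a x - pd (fun y => ω y ![a, f]) e x +
      pd (fun y => ω y ![a, e]) f x := by
  have h0 : (fun j => ![a, e, f] (Fin.succAbove (0 : Fin 3) j)) = ![e, f] := by
    funext t; fin_cases t <;> rfl
  have h1 : (fun j => ![a, e, f] (Fin.succAbove (1 : Fin 3) j)) = ![a, f] := by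
    funext t; fin_cases t <;> rfl
  have h2 : (fun j => ![a, e, f] (Fin.succAbove (2 : Fin 3) j)) = ![a, e] := by
    funext t; fin_cases t <;> rfl
  change ∑ i : Fin 3, _ = _
  rw [Fin.sum_univ_three]
  simp only [h0, h1, h2, pd]
  simp
  ring

theorem AlmostSymp.mono {N : ℕ} {ω Λ : Form N 2} {M W : Set (Pt N)} (h : AlmostSymp ω Λ M)
    (hWM : W ⊆ M) : AlmostSymp ω Λ W :=
  ⟨⟨fun x hx => h.1.1 x (hWM hx), fun I => (h.1.2 I).mono hWM⟩,
    ⟨fun x hx => h.2.1.1 x (hWM hx), fun I => (h.2.1.2 I).mono hWM⟩,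
    fun x hx => h.2.2 x (hWM hx)⟩

theorem IsFormOn.mat2_transpose {N : ℕ} {ω : Form N 2} {M : Set (Pt N)} (h : IsFormOn ω M)
    {x : Pt N} (hx : x ∈ M) : (mat2 ω x).transpose = -mat2 ω x := by
  ext i j
  exact Alt.swap_two (h.1 x hx).1 j i

theorem IsFormOn.differentiableAt {N p : ℕ} {ω : Form N p} {M : Set (Pt N)} (h : IsFormOn ω M)
    (hM : IsOpen M) {x : Pt N} (hx : x ∈ M) (I : Fin p → Fin N) :
    DifferentiableAt ℝ (fun y => ω y I) x :=
  ((h.2 I).contDiffAt (hM.mem_nhds hx)).differentiableAt (by simp)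

section DiracStructure

variable {n m : ℕ} {W : Set (Pt (2 * n))} {ω₀ Λ₀ : Form (2 * n) 2} {f : Fin m → Pt (2 * n) → ℝ}
  {c : Fin m → Fin m → Pt (2 * n) → ℝ} {x : Pt (2 * n)}

theorem AlmostSymp.jac_mul (hinv : ∀ x ∈ W,
      (Matrix.of fun i j => braF Λ₀ (f i) (f j) x) * (Matrix.of fun i j => c i j x) = 1)
    (hx : x ∈ W) : (jac f x * mat2 Λ₀ x * (jac f x).transpose) *
      (Matrix.of fun i j => c i j x) = 1 := by
  rw [← braF_eq_mul, hinv x hx]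

theorem AlmostSymp.mat2_sigma (hsymp : AlmostSymp ω₀ Λ₀ W) (hinv : ∀ x ∈ W,
      (Matrix.of fun i j => braF Λ₀ (f i) (f j) x) * (Matrix.of fun i j => c i j x) = 1)
    (hx : x ∈ W) : mat2 (sigmaDirac m ω₀ f c) x =
      mat2 ω₀ x + (jac f x).transpose * (Matrix.of fun i j => c i j x) * jac f x :=
  mat2_sigmaDirac ω₀ f c x
    (dirac_antisymm (hsymp.2.1.mat2_transpose hx) (AlmostSymp.jac_mul hinv hx))

theorem AlmostSymp.mat2_sharp_sigma (hsymp : AlmostSymp ω₀ Λ₀ W) (hinv : ∀ x ∈ W,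
      (Matrix.of fun i j => braF Λ₀ (f i) (f j) x) * (Matrix.of fun i j => c i j x) = 1)
    (hx : x ∈ W) : mat2 (sharpF Λ₀ 2 (sigmaDirac m ω₀ f c)) x =
      mat2 Λ₀ x - mat2 Λ₀ x * (jac f x).transpose * (Matrix.of fun i j => c i j x) *
        (jac f x * mat2 Λ₀ x) := by
  rw [mat2_sharpF, hsymp.mat2_sigma hinv hx,
    dirac_sharp (hsymp.2.2 x hx) (hsymp.2.1.mat2_transpose hx)]

theorem AlmostSymp.mul_mat2 (hsymp : AlmostSymp ω₀ Λ₀ W) (hx : x ∈ W) :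
    mat2 Λ₀ x * mat2 ω₀ x = -1 := by
  have h : (-mat2 Λ₀ x) * mat2 ω₀ x = 1 := by
    rw [mul_eq_one_comm]; simp [hsymp.2.2 x hx]
  rw [← h]; simp

theorem AlmostSymp.sharp_sigma_mul (hsymp : AlmostSymp ω₀ Λ₀ W) (hinv : ∀ x ∈ W,
      (Matrix.of fun i j => braF Λ₀ (f i) (f j) x) * (Matrix.of fun i j => c i j x) = 1)
    (hx : x ∈ W) : mat2 (sharpF Λ₀ 2 (sigmaDirac m ω₀ f c)) x * mat2 ω₀ x =
      mat2 Λ₀ x * (jac f x).transpose * (Matrix.of fun i j => c i j x) * jac f x - 1 := by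
  rw [hsymp.mat2_sharp_sigma hinv hx, Matrix.sub_mul, hsymp.mul_mat2 hx, Matrix.mul_assoc,
    Matrix.mul_assoc (jac f x), hsymp.mul_mat2 hx]
  simp
  abel

theorem AlmostSymp.jac_mul_sharp_sigma (hsymp : AlmostSymp ω₀ Λ₀ W) (hinv : ∀ x ∈ W,
      (Matrix.of fun i j => braF Λ₀ (f i) (f j) x) * (Matrix.of fun i j => c i j x) = 1)
    (hx : x ∈ W) : jac f x * mat2 (sharpF Λ₀ 2 (sigmaDirac m ω₀ f c)) x = 0 := by
  have h := AlmostSymp.jac_mul hinv hx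
  rw [hsymp.mat2_sharp_sigma hinv hx, Matrix.mul_sub]
  simp only [← Matrix.mul_assoc] at h ⊢
  rw [h]
  simp

theorem AlmostSymp.sharp_sigma_mul_self (hsymp : AlmostSymp ω₀ Λ₀ W) (hinv : ∀ x ∈ W,
      (Matrix.of fun i j => braF Λ₀ (f i) (f j) x) * (Matrix.of fun i j => c i j x) = 1)
    (hx : x ∈ W) : mat2 (sharpF Λ₀ 2 (sigmaDirac m ω₀ f c)) x * mat2 ω₀ x *
      mat2 (sharpF Λ₀ 2 (sigmaDirac m ω₀ f c)) x =
      -mat2 (sharpF Λ₀ 2 (sigmaDirac m ω₀ f c)) x := by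
  rw [hsymp.sharp_sigma_mul hinv hx, Matrix.sub_mul, Matrix.mul_assoc,
    hsymp.jac_mul_sharp_sigma hinv hx]
  simp

theorem differentiableAt_sigmaDirac (hWo : IsOpen W) (hω : IsFormOn ω₀ W)
    (hf : ∀ i, ContDiffOn ℝ (⊤ : ℕ∞) (f i) W) (hc : ∀ i j, ContDiffOn ℝ (⊤ : ℕ∞) (c i j) W)
    (hx : x ∈ W) (I : Fin 2 → Fin (2 * n)) :
    DifferentiableAt ℝ (fun y => sigmaDirac m ω₀ f c y I) x := by
  have hd (i : Fin m) (J : Fin 1 → Fin (2 * n)) : DifferentiableAt ℝ (fun y => dF (f i) y J) x :=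
    ((contDiffOn_pd hWo (hf i) (J 0)).contDiffAt (hWo.mem_nhds hx)).differentiableAt (by simp)
  refine (hω.differentiableAt hWo hx I).fun_add (DifferentiableAt.fun_sum fun i _ =>
    DifferentiableAt.fun_sum fun j _ => ?_)
  split_ifs
  · exact (((hc i j).contDiffAt (hWo.mem_nhds hx)).differentiableAt (by simp)).fun_mul
      (differentiableAt_wedgeF (hd i) (hd j) I)
  · exact differentiableAt_const _

/-- The Dirac bracket satisfies the Jacobi identity. -/
theorem AlmostSymp.jacobi_sharp_sigma (hWo : IsOpen W) (hsymp : AlmostSymp ω₀ Λ₀ W)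
    (hclosed : ∀ x ∈ W, ∀ I : Fin 3 → Fin (2 * n), extd ω₀ x I = 0)
    (hf : ∀ i, ContDiffOn ℝ (⊤ : ℕ∞) (f i) W) (hc : ∀ i j, ContDiffOn ℝ (⊤ : ℕ∞) (c i j) W)
    (hinv : ∀ x ∈ W,
      (Matrix.of fun i j => braF Λ₀ (f i) (f j) x) * (Matrix.of fun i j => c i j x) = 1)
    (hx : x ∈ W) {P : Form (2 * n) 2} (hPdef : P = sharpF Λ₀ 2 (sigmaDirac m ω₀ f c))
    (b c' d : Fin (2 * n)) :
    ∑ a, (P x ![a, b] * pd (fun y => P y ![c', d]) a x +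
      P x ![a, c'] * pd (fun y => P y ![d, b]) a x +
      P x ![a, d] * pd (fun y => P y ![b, c']) a x) = 0 := by
  have hWx : W ∈ nhds x := hWo.mem_nhds hx
  have hPa (y) (hy : y ∈ W) (i j) : P y ![i, j] = -P y ![j, i] := by
    rw [hPdef]
    exact (alt_sharpF Λ₀ (alt_sigmaDirac f c (hsymp.1.1 y hy).1)).swap_two i j
  have hωa (y) (hy : y ∈ W) (i j) : ω₀ y ![i, j] = -ω₀ y ![j, i] :=
    Alt.swap_two (hsymp.1.1 y hy).1 i j
  have dP (i j) : DifferentiableAt ℝ (fun y => mat2 P y i j) x := by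
    rw [hPdef]
    exact differentiableAt_sharpF (hsymp.2.1.differentiableAt hWo hx)
      (differentiableAt_sigmaDirac hWo hsymp.1 hf hc hx) _
  have dω (i j) : DifferentiableAt ℝ (fun y => mat2 ω₀ y i j) x :=
    hsymp.1.differentiableAt hWo hx _
  have dG (i a) : DifferentiableAt ℝ (fun y => jac f y i a) x :=
    ((contDiffOn_pd hWo (hf i) a).contDiffAt hWx).differentiableAt (by simp)
  have hder (a : Fin (2 * n)) : pdM (mat2 P) a x =
      mat2 P x * pdM (mat2 ω₀) a x * mat2 P x -
      mat2 P x * (pdM (jac f) a x).transpose *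
        (mat2 Λ₀ x * (jac f x).transpose * (Matrix.of fun i j => c i j x)).transpose -
      (mat2 Λ₀ x * (jac f x).transpose * (Matrix.of fun i j => c i j x)) * pdM (jac f) a x *
        mat2 P x := by
    refine deriv_eq_of_dirac (Ω := mat2 ω₀ x) (G := jac f x) ?_ ?_
      (hsymp.1.mat2_transpose hx) ?_ ?_ ?_
    · ext i j
      exact hPa x hx j i
    · ext i j
      have h : pd (fun y => P y ![j, i]) a x = pd (fun y => -P y ![i, j]) a x :=
        pd_congr (Filter.mem_of_superset hWx fun y hy => hPa y hy j i) a
      refine h.trans ?_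
      simp [pd, pdM, mat2]
    · rw [hPdef]
      exact hsymp.sharp_sigma_mul hinv hx
    · rw [← Matrix.add_mul, ← pdM_mul dP dω, ← pdM_mul (differentiableAt_matrix_mul dP dω) dP,
        ← pdM_neg]
      refine pdM_congr (Filter.mem_of_superset hWx fun y hy => ?_) a
      rw [hPdef]
      exact hsymp.sharp_sigma_mul_self hinv hy
    · rw [← pdM_mul dG dP]
      have h : pdM (fun y => jac f y * mat2 P y) a x = pdM (fun _ => 0) a x := by
        refine pdM_congr (Filter.mem_of_superset hWx fun y hy => ?_) a
        rw [hPdef]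
        exact hsymp.jac_mul_sharp_sigma hinv hy
      rw [h]
      ext i j
      simp [pdM, pd]
  have hH (a e : Fin (2 * n)) (i : Fin m) : pdM (jac f) a x i e = pdM (jac f) e x i a :=
    pd_comm hWo (hf i) hx e a
  have hdω (a e g : Fin (2 * n)) : pdM (mat2 ω₀) a x e g + pdM (mat2 ω₀) e x g a +
      pdM (mat2 ω₀) g x a e = 0 := by
    have h := hclosed x hx ![a, e, g]
    rw [extd_two_apply] at h
    have h' : pd (fun y => ω₀ y ![a, g]) e x = -pd (fun y => ω₀ y ![g, a]) e x := by
      have h1 : pd (fun y => ω₀ y ![a, g]) e x = pd (fun y => -ω₀ y ![g, a]) e x :=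
        pd_congr (Filter.mem_of_superset hWx fun y hy => hωa y hy a g) e
      rw [h1]
      simp [pd]
    rw [h', sub_neg_eq_add] at h
    exact h
  exact jacobi_of_deriv_eq (P := mat2 P x) (dP := fun a => pdM (mat2 P) a x)
    (dΩ := fun a => pdM (mat2 ω₀) a x) (H := fun a => pdM (jac f) a x)
    (hPa x hx) hH hdω hder b c' d

end DiracStructure

theorem dirac_sigma_properties
    (n k : ℕ) (hk : 2 ≤ k) (hkn : k ≤ n)
    (M : Set (Pt (2 * n))) (hMo : IsOpen M) (hMne : M.Nonempty)
    -- symplectic structure: almost symplectic with dω₀ = 0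
    (ω₀ Λ₀ : Form (2 * n) 2) (hsymp : AlmostSymp ω₀ Λ₀ M)
    (hclosed : ∀ x ∈ M, ∀ I : Fin 3 → Fin (2 * n), extd ω₀ x I = 0)
    -- the constraints, with everywhere independent differentials
    (f : Fin (2 * (n - k)) → Pt (2 * n) → ℝ)
    (hf : ∀ i, ContDiffOn ℝ (⊤ : ℕ∞) (f i) M)
    (hind : ∀ x ∈ M, LinearIndependent ℝ fun i => grad (f i) x)
    -- W : open subset on which ({f_i,f_j}₀) is invertible with smooth inverse (c_{ij})
    (W : Set (Pt (2 * n))) (hWo : IsOpen W) (hWM : W ⊆ M)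
    (c : Fin (2 * (n - k)) → Fin (2 * (n - k)) → Pt (2 * n) → ℝ)
    (hc : ∀ i j, ContDiffOn ℝ (⊤ : ℕ∞) (c i j) W)
    (hinv : ∀ x ∈ W,
      (Matrix.of fun i j => braF Λ₀ (f i) (f j) x) * (Matrix.of fun i j => c i j x) = 1) :
    -- (a) σ(X_{f_l},·) = 0 on W
    (∀ x ∈ W, ∀ l, ∀ b,
        ∑ a, sigmaDirac (2 * (n - k)) ω₀ f c x ![a, b] * hamV Λ₀ (f l) x a = 0) ∧
    -- (b) σ has rank 2k at every point of W
    (∀ x ∈ W, Matrix.rank (mat2 (sigmaDirac (2 * (n - k)) ω₀ f c) x) = 2 * k) ∧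
    -- (c) i_{Λ₀}σ = -⟨σ,Λ₀⟩ = -k on W
    (∀ x ∈ W, -(pairF (sigmaDirac (2 * (n - k)) ω₀ f c) Λ₀ x) = -(k : ℝ)) ∧
    -- (d) 2σ∧δ(σ) = δ(σ∧σ) on W
    DeltaCond ω₀ Λ₀ (sigmaDirac (2 * (n - k)) ω₀ f c) W := by
  have hs := hsymp.mono hWM
  have hfW : ∀ i, ContDiffOn ℝ (⊤ : ℕ∞) (f i) W := fun i => (hf i).mono hWM
  refine ⟨fun x hx l b => ?_, fun x hx => ?_, fun x hx => ?_, fun x hx I => ?_⟩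
  · have h := congrFun (congrFun (dirac_mul_eq_zero (hs.2.2 x hx)
      (AlmostSymp.jac_mul hinv hx)) l) b
    rw [← hs.mat2_sigma hinv hx, Matrix.mul_apply] at h
    refine Eq.trans (Finset.sum_congr rfl fun a _ => ?_) h
    rw [mul_comm]
    refine congrArg (· * _) ?_
    simp only [hamV, sharpV, grad, jac, mat2, Matrix.mul_apply, Matrix.of_apply]
    exact Finset.sum_congr rfl fun i _ => mul_comm _ _
  · have h := dirac_rank (hs.2.2 x hx) (AlmostSymp.jac_mul hinv hx) (hind x (hWM hx))
    rw [← hs.mat2_sigma hinv hx] at h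
    simp only [Fintype.card_fin] at h
    omega
  · have h := dirac_trace (hs.2.2 x hx) (AlmostSymp.jac_mul hinv hx)
    rw [← hs.mat2_sigma hinv hx] at h
    simp only [Fintype.card_fin, Matrix.trace, Matrix.diag_apply, Matrix.mul_apply] at h
    have e : ∑ a, ∑ b, sigmaDirac (2 * (n - k)) ω₀ f c x ![a, b] * Λ₀ x ![a, b] =
        -∑ a, ∑ b, mat2 (sigmaDirac (2 * (n - k)) ω₀ f c) x a b * mat2 Λ₀ x b a := by
      simp only [← Finset.sum_neg_distrib, mat2, Matrix.of_apply]
      refine Finset.sum_congr rfl fun a _ => Finset.sum_congr rfl fun b _ => ?_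
      rw [Alt.swap_two (hs.2.1.1 x hx).1 a b]
      ring
    rw [pairF, sum_fin_two_arrow, e, h]
    push_cast [Nat.cast_sub hkn]
    norm_num
    ring
  · refine codiffF_wedgeF_of_jacobi (hk.trans hkn)
      (Filter.mem_of_superset (hWo.mem_nhds hx) fun y hy => alt_sigmaDirac f c (hs.1.1 y hy).1)
      (Alt.swap_two (hs.2.1.1 x hx).1) ?_ (hs.1.differentiableAt hWo hx)
      (hs.2.1.differentiableAt hWo hx) (differentiableAt_sigmaDirac hWo hs.1 hfW hc hx) ?_
      (hs.jacobi_sharp_sigma hWo (fun y hy => hclosed y (hWM hy)) hfW hc hinv hx rfl) I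
    · rw [hs.2.1.mat2_transpose hx, Matrix.neg_mul, hs.mul_mat2 hx, neg_neg]
    · intro i j
      have h : mat2 ω₀ x * mat2 (sharpF Λ₀ 2 (sigmaDirac (2 * (n - k)) ω₀ f c)) x *
          (mat2 ω₀ x).transpose = mat2 (sigmaDirac (2 * (n - k)) ω₀ f c) x := by
        rw [hs.1.mat2_transpose hx, mat2_sharpF, hs.2.1.mat2_transpose hx]
        calc _ = (mat2 ω₀ x * mat2 Λ₀ x) * mat2 (sigmaDirac (2 * (n - k)) ω₀ f c) x *
              (mat2 Λ₀ x * mat2 ω₀ x) := by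
              simp only [Matrix.mul_assoc, Matrix.mul_neg, Matrix.neg_mul, neg_neg]
          _ = _ := by rw [hs.2.2 x hx, hs.mul_mat2 hx]; simp
      refine Eq.trans ?_ (congrFun (congrFun h i) j)
      simp only [Matrix.mul_apply, Finset.sum_mul, Matrix.transpose_apply, mat2, Matrix.of_apply]
      rw [Finset.sum_comm]
      exact Finset.sum_congr rfl fun a _ => Finset.sum_congr rfl fun b _ => by ring

end
end Damianou
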